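/- Let w be a weight on ℝⁿ with [w]^{weak}_{A∞} < ∞ and let f ∈ BMO. Then there exists a dimensional constant c_n, independent of f and w, such that for every cube Q and every p ≥ 1, ( (1/w(2Q)) ∫_Q |f − f_Q|^p w dx )^{1/p} ≤ c_n · p · [w]^{weak}_{A∞} · ‖f‖_{BMO}. -/

import Mathlib

open MeasureTheory ENNReal Set

noncomputable section

/-- The axis-parallel cube in `ℝⁿ` with lower corner `a` and side length `h`. -/
def Cube {n : ℕ} (a : Fin n → ℝ) (h : ℝ) : Set (Fin n → ℝ) :=
  Set.univ.pi fun i => Set.Icc (a i) (a i + h)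

/-- The concentric double `2Q` of the cube with lower corner `a` and side length `h`. -/
def Cube2 {n : ℕ} (a : Fin n → ℝ) (h : ℝ) : Set (Fin n → ℝ) :=
  Cube (fun i => a i - h / 2) (2 * h)

/-- The average `f_Q` of `f` over the cube with lower corner `a` and side length `h`. -/
def cubeAvg {n : ℕ} (a : Fin n → ℝ) (h : ℝ) (f : (Fin n → ℝ) → ℝ) : ℝ :=
  ⨍ x in Cube a h, f x

/-- The (uncentered) Hardy–Littlewood maximal function over axis-parallel cubes. -/
def maxFn {n : ℕ} (f : (Fin n → ℝ) → ℝ) (x : Fin n → ℝ) : ℝ≥0∞ :=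
  ⨆ (a : Fin n → ℝ) (h : ℝ) (_ : 0 < h) (_ : x ∈ Cube a h),
    (∫⁻ y in Cube a h, ENNReal.ofReal |f y|) / volume (Cube a h)

/-- The BMO seminorm `sup_Q (1/|Q|) ∫_Q |f - f_Q|`, valued in `ℝ≥0∞`. -/
def bmoNorm {n : ℕ} (f : (Fin n → ℝ) → ℝ) : ℝ≥0∞ :=
  ⨆ (a : Fin n → ℝ) (h : ℝ) (_ : 0 < h),
    (∫⁻ x in Cube a h, ENNReal.ofReal |f x - cubeAvg a h f|) / volume (Cube a h)

/-- The generalized weighted BMO norm `‖f‖_{BMO_{v,Y}} = sup_Q (1/Y(Q)) ∫_Q |f - f_Q| v`. -/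
def bmoVY {n : ℕ} (v : (Fin n → ℝ) → ℝ) (Y : (Fin n → ℝ) → ℝ → ℝ≥0∞)
    (f : (Fin n → ℝ) → ℝ) : ℝ≥0∞ :=
  ⨆ (a : Fin n → ℝ) (h : ℝ) (_ : 0 < h),
    (∫⁻ x in Cube a h, ENNReal.ofReal (|f x - cubeAvg a h f| * v x)) / Y a h

/-- `w(Q) = ∫_Q w` for a cube `Q`. -/
def wInt {n : ℕ} (w : (Fin n → ℝ) → ℝ) (a : Fin n → ℝ) (h : ℝ) : ℝ≥0∞ :=
  ∫⁻ x in Cube a h, ENNReal.ofReal (w x)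

/-- `w(2Q) = ∫_{2Q} w` for a cube `Q`. -/
def wInt2 {n : ℕ} (w : (Fin n → ℝ) → ℝ) (a : Fin n → ℝ) (h : ℝ) : ℝ≥0∞ :=
  ∫⁻ x in Cube2 a h, ENNReal.ofReal (w x)

/-- The generalized Fujii–Wilson constant `[v]_{A_{∞,Y}} = sup_Q (1/Y(Q)) ∫_Q M(v χ_Q)`. -/
def fwY {n : ℕ} (v : (Fin n → ℝ) → ℝ) (Y : (Fin n → ℝ) → ℝ → ℝ≥0∞) : ℝ≥0∞ :=
  ⨆ (a : Fin n → ℝ) (h : ℝ) (_ : 0 < h),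
    (∫⁻ x in Cube a h, maxFn ((Cube a h).indicator v) x) / Y a h

/-- The Fujii–Wilson `A∞` constant `[w]_{A∞} = sup_Q (1/w(Q)) ∫_Q M(w χ_Q)`. -/
def fwConst {n : ℕ} (w : (Fin n → ℝ) → ℝ) : ℝ≥0∞ :=
  ⨆ (a : Fin n → ℝ) (h : ℝ) (_ : 0 < h),
    (∫⁻ x in Cube a h, maxFn ((Cube a h).indicator w) x) / wInt w a h

/-- The weak Fujii–Wilson constant `[w]^{weak}_{A∞} = sup_Q (1/w(2Q)) ∫_Q M(w χ_Q)`. -/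
def fwWeak {n : ℕ} (w : (Fin n → ℝ) → ℝ) : ℝ≥0∞ :=
  ⨆ (a : Fin n → ℝ) (h : ℝ) (_ : 0 < h),
    (∫⁻ x in Cube a h, maxFn ((Cube a h).indicator w) x) / wInt2 w a h

/-- The `C_p` normalizing functional `Y(Q) = ∫_{ℝⁿ} M(χ_Q)^p w`. -/
def cpY {n : ℕ} (p : ℝ) (w : (Fin n → ℝ) → ℝ) (a : Fin n → ℝ) (h : ℝ) : ℝ≥0∞ :=
  ∫⁻ x, (maxFn ((Cube a h).indicator fun _ => (1 : ℝ)) x) ^ p * ENNReal.ofReal (w x)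

/-- The `C_p` Fujii–Wilson-type constant `[w]_{C_p}`. -/
def cpConst {n : ℕ} (p : ℝ) (w : (Fin n → ℝ) → ℝ) : ℝ≥0∞ :=
  ⨆ (a : Fin n → ℝ) (h : ℝ) (_ : 0 < h),
    (∫⁻ x in Cube a h, maxFn ((Cube a h).indicator w) x) / cpY p w a h

/-- The `A_p` constant `[w]_{A_p}` for `1 < p < ∞`. -/
def apConst {n : ℕ} (p : ℝ) (w : (Fin n → ℝ) → ℝ) : ℝ≥0∞ :=
  ⨆ (a : Fin n → ℝ) (h : ℝ) (_ : 0 < h),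
    (wInt w a h / volume (Cube a h)) *
      ((∫⁻ x in Cube a h, ENNReal.ofReal (w x) ^ (1 - p / (p - 1))) / volume (Cube a h)) ^ (p - 1)

/-- A weight: a nonnegative locally integrable function on `ℝⁿ`. -/
def IsWeight {n : ℕ} (v : (Fin n → ℝ) → ℝ) : Prop :=
  (∀ x, 0 ≤ v x) ∧ LocallyIntegrable v volume

/-- A cube functional `Y : 𝒬 → (0,∞)`: positive finite values on cubes. -/
def IsCubeFunctional {n : ℕ} (Y : (Fin n → ℝ) → ℝ → ℝ≥0∞) : Prop :=
  ∀ (a : Fin n → ℝ) (h : ℝ), 0 < h → 0 < Y a h ∧ Y a h < ⊤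

/-- Membership in the class `𝒴_q` with constant `β`: for every cube `Q`, every `L ≥ 1`
and every `L`-small family of pairwise non-overlapping subcubes of `Q`,
`∑_{P ∈ Λ} Y(P) ≤ β Y(Q) L^{-1/q}`. -/
def MemY {n : ℕ} (q β : ℝ) (Y : (Fin n → ℝ) → ℝ → ℝ≥0∞) : Prop :=
  ∀ (a : Fin n → ℝ) (h : ℝ), 0 < h → ∀ L : ℝ, 1 ≤ L →
    ∀ Λ : Set ((Fin n → ℝ) × ℝ),
      (∀ p ∈ Λ, 0 < p.2 ∧ Cube p.1 p.2 ⊆ Cube a h) →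
      (Λ.Pairwise fun p r => Disjoint (interior (Cube p.1 p.2)) (interior (Cube r.1 r.2))) →
      (∑' p : Λ, volume (Cube p.1.1 p.1.2)) ≤ volume (Cube a h) / ENNReal.ofReal L →
      (∑' p : Λ, Y p.1.1 p.1.2) ≤ ENNReal.ofReal β * Y a h * ENNReal.ofReal (L ^ (-1 / q))

/-- The Luxemburg norm in the Orlicz space `exp L^β` with respect to the measure `μ`. -/
def expLuxNorm {X : Type*} [MeasurableSpace X] (μ : Measure X) (β : ℝ) (g : X → ℝ) : ℝ≥0∞ :=
  ⨅ (lam : ℝ) (_ : 0 < lam)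
    (_ : ∫⁻ x, ENNReal.ofReal (Real.exp ((|g x| / lam) ^ β) - 1) ∂μ ≤ 1), ENNReal.ofReal lam

/-- The weighted measure `w dx` restricted to a set `Q`. -/
def wMeasureOn {n : ℕ} (w : (Fin n → ℝ) → ℝ) (Q : Set (Fin n → ℝ)) : Measure (Fin n → ℝ) :=
  (volume.restrict Q).withDensity fun x => ENNReal.ofReal (w x)

/-- The dyadic grid `𝒟(Q)` relative to the cube with lower corner `a₀` and side `h₀`:
parameters of all dyadic subcubes of `Q`. -/
def dyadicOf {n : ℕ} (a₀ : Fin n → ℝ) (h₀ : ℝ) : Set ((Fin n → ℝ) × ℝ) :=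
  {p | ∃ (k : ℕ) (m : Fin n → ℕ), (∀ i, m i < 2 ^ k) ∧
    p.2 = h₀ / 2 ^ k ∧ p.1 = fun i => a₀ i + (m i : ℝ) * (h₀ / 2 ^ k)}

/-- The functional `w_r(Q) = |Q| ((1/|Q|) ∫_Q w^r)^{1/r}`. -/
def wrY {n : ℕ} (w : (Fin n → ℝ) → ℝ) (r : ℝ) (a : Fin n → ℝ) (h : ℝ) : ℝ≥0∞ :=
  volume (Cube a h) *
    ((∫⁻ x in Cube a h, ENNReal.ofReal (w x) ^ r) / volume (Cube a h)) ^ (1 / r)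

open Metric

/-- An eighth of the distance to the complement of `Ω`. -/
def whitneyRadius {n : ℕ} (Ω : Set (Fin n → ℝ)) (y : Fin n → ℝ) : ℝ := infDist y Ωᶜ / 8

lemma whitneyRadius_pos {n : ℕ} {Ω : Set (Fin n → ℝ)} (hΩ : IsOpen Ω) (hne : Ωᶜ.Nonempty)
    {y : Fin n → ℝ} (hy : y ∈ Ω) : 0 < whitneyRadius Ω y := by
  have := (hΩ.isClosed_compl.notMem_iff_infDist_pos hne).1 (fun h => h hy)
  unfold whitneyRadius
  positivity

lemma whitneyRadius_le {n : ℕ} (Ω : Set (Fin n → ℝ)) (x y : Fin n → ℝ) :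
    8 * whitneyRadius Ω x ≤ 8 * whitneyRadius Ω y + dist x y := by
  have := infDist_le_infDist_add_dist (s := Ωᶜ) (x := x) (y := y)
  unfold whitneyRadius
  linarith

lemma continuous_whitneyRadius {n : ℕ} (Ω : Set (Fin n → ℝ)) :
    Continuous (whitneyRadius Ω) :=
  (continuous_infDist_pt _).div_const _

lemma mem_of_dist_lt_whitneyRadius {n : ℕ} {Ω : Set (Fin n → ℝ)} {x y : Fin n → ℝ}
    (h : dist x y < 8 * whitneyRadius Ω x) : y ∈ Ω := by
  by_contra hy
  have := infDist_le_dist_of_mem (x := x) (show y ∈ Ωᶜ from hy)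
  unfold whitneyRadius at h
  linarith

lemma volume_closedBall_fin {n : ℕ} (x : Fin n → ℝ) {r : ℝ} (hr : 0 ≤ r) :
    volume (closedBall x r) = ENNReal.ofReal (2 * r) ^ n := by
  rw [Real.volume_pi_closedBall _ hr, Fintype.card_fin, ENNReal.ofReal_pow (by positivity)]

lemma lintegral_measure_closedBall_swap {n : ℕ} (m m' : Measure (Fin n → ℝ)) [SFinite m]
    [SFinite m'] {ρ : (Fin n → ℝ) → ℝ} (hρ : Continuous ρ) {k : (Fin n → ℝ) → ℝ≥0∞}
    (hk : Measurable k) :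
    ∫⁻ y, k y * m (closedBall y (ρ y)) ∂m' =
      ∫⁻ x, ∫⁻ y, {y | dist x y ≤ ρ y}.indicator k y ∂m' ∂m := by
  have h1 : ∀ y, k y * m (closedBall y (ρ y)) =
      ∫⁻ x, {y | dist x y ≤ ρ y}.indicator k y ∂m := by
    intro y
    have : (fun x => {y | dist x y ≤ ρ y}.indicator k y) =
        (closedBall y (ρ y)).indicator (fun _ => k y) := by
      ext x
      simp [Set.indicator, mem_closedBall]
    rw [this, lintegral_indicator measurableSet_closedBall, lintegral_const,
      Measure.restrict_apply_univ]
  simp_rw [h1]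
  apply lintegral_lintegral_swap
  have h2 : (Function.uncurry fun y x => {y | dist x y ≤ ρ y}.indicator k y) =
      {p : (Fin n → ℝ) × (Fin n → ℝ) | dist p.2 p.1 ≤ ρ p.1}.indicator (fun p => k p.1) := by
    ext ⟨y, x⟩
    simp [Set.indicator, Function.uncurry]
  rw [h2]
  apply Measurable.aemeasurable
  apply (hk.comp measurable_fst).indicator
  exact (isClosed_le (continuous_snd.dist continuous_fst)
    (hρ.comp continuous_fst)).measurableSet

/-- A bound on Whitney cubes of an open set, expressed by averaging rather than by selecting a
covering. -/
lemma measure_le_of_whitney {n : ℕ} {Ω : Set (Fin n → ℝ)} (hΩ : IsOpen Ω) (hne : Ωᶜ.Nonempty)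
    (μ ν : Measure (Fin n → ℝ)) [SFinite μ] [SFinite ν] {E : Set (Fin n → ℝ)}
    (hE : MeasurableSet E) (hEΩ : E ⊆ Ω) {c : ℝ≥0∞} (hc : c ≠ ⊤)
    (h : ∀ y ∈ Ω, μ (E ∩ closedBall y (whitneyRadius Ω y)) ≤
      c * ν (closedBall y (3 * whitneyRadius Ω y))) :
    μ E ≤ 40 ^ n * c * ν Ω := by
  set d := whitneyRadius Ω with hd
  have hdc : Continuous d := continuous_whitneyRadius Ω
  set k : (Fin n → ℝ) → ℝ≥0∞ := fun y => (ENNReal.ofReal (d y) ^ n)⁻¹ with hk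
  have hkm : Measurable k := ((hdc.measurable.ennreal_ofReal).pow_const n).inv
  have low : ∀ x ∈ E, (1 : ℝ≥0∞) ≤
      2 ^ n * ∫⁻ y in Ω, {y | dist x y ≤ d y}.indicator k y := by
    intro x hx
    have hdx : 0 < d x := whitneyRadius_pos hΩ hne (hEΩ hx)
    have key : ∀ y ∈ closedBall x (d x / 2),
        y ∈ Ω ∧ dist x y ≤ d y ∧ d y ≤ 2 * d x ∧ 0 < d y := by
      intro y hy
      rw [mem_closedBall, dist_comm] at hy
      have h1 := whitneyRadius_le Ω x y
      have h2 := whitneyRadius_le Ω y x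
      rw [dist_comm y x] at h2
      simp only [← hd] at h1 h2
      refine ⟨mem_of_dist_lt_whitneyRadius (x := x) ?_, ?_, ?_, ?_⟩
      · rw [← hd]; linarith
      all_goals linarith
    calc (1 : ℝ≥0∞) = 2 ^ n * ((ENNReal.ofReal (2 * d x) ^ n)⁻¹ *
          volume (closedBall x (d x / 2))) := by
          rw [volume_closedBall_fin x (by positivity), mul_div_cancel₀ _ (two_ne_zero' ℝ),
            ENNReal.ofReal_mul zero_le_two, mul_pow, ENNReal.ofReal_ofNat,
            ENNReal.mul_inv (by simp) (by simp), mul_assoc, ENNReal.inv_mul_cancel,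
            mul_one, ENNReal.mul_inv_cancel]
          · simp
          · simp
          · simp [hdx]
          · simp
      _ ≤ _ := by
          gcongr
          rw [← Measure.restrict_apply_univ (s := closedBall x (d x / 2)), ← lintegral_const]
          refine le_trans ?_ (lintegral_mono_set (fun y hy => (key y hy).1))
          refine setLIntegral_mono' measurableSet_closedBall fun y hy => ?_
          obtain ⟨_, h1, h2, h3⟩ := key y hy
          rw [Set.indicator_of_mem (by exact h1)]
          simp only [hk]
          gcongr
  have up : ∀ z ∈ Ω, ∫⁻ y in Ω, {y | dist z y ≤ 3 * d y}.indicator k y ≤ 20 ^ n := by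
    intro z hz
    have hdz : 0 < d z := whitneyRadius_pos hΩ hne hz
    have key : ∀ y, dist z y ≤ 3 * d y →
        y ∈ closedBall z (5 * d z) ∧ d z / 2 ≤ d y := by
      intro y hy
      have h1 := whitneyRadius_le Ω z y
      have h2 := whitneyRadius_le Ω y z
      rw [dist_comm y z] at h2
      simp only [← hd] at h1 h2
      have h3 : 0 ≤ d y := by
        have := infDist_nonneg (x := y) (s := Ωᶜ)
        simp only [hd, whitneyRadius]
        positivity
      refine ⟨?_, ?_⟩
      · rw [mem_closedBall, dist_comm]; linarith
      all_goals linarith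
    calc ∫⁻ y in Ω, {y | dist z y ≤ 3 * d y}.indicator k y
        ≤ ∫⁻ y, {y | dist z y ≤ 3 * d y}.indicator k y := setLIntegral_le_lintegral _ _
      _ ≤ ∫⁻ y, (closedBall z (5 * d z)).indicator
            (fun _ => (ENNReal.ofReal (d z / 2) ^ n)⁻¹) y := by
          refine lintegral_mono fun y => ?_
          by_cases hy : dist z y ≤ 3 * d y
          · obtain ⟨h1, h2⟩ := key y hy
            rw [Set.indicator_of_mem (by exact hy), Set.indicator_of_mem h1]
            simp only [hk]
            gcongr
          · rw [Set.indicator_of_notMem (by exact hy)]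
            exact zero_le
      _ = 20 ^ n := by
          rw [lintegral_indicator measurableSet_closedBall, lintegral_const,
            Measure.restrict_apply_univ, volume_closedBall_fin z (by positivity),
            show 2 * (5 * d z) = 20 * (d z / 2) by ring,
            ENNReal.ofReal_mul (by norm_num : (0:ℝ) ≤ 20), mul_pow, ENNReal.ofReal_ofNat,
            mul_comm, mul_assoc, ENNReal.mul_inv_cancel, mul_one]
          · simp [hdz]
          · simp
  have hΩm := hΩ.measurableSet
  calc μ E = ∫⁻ x in E, 1 ∂μ := by simp
    _ ≤ ∫⁻ x in E, 2 ^ n * (∫⁻ y in Ω, {y | dist x y ≤ d y}.indicator k y) ∂μ :=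
        setLIntegral_mono' hE low
    _ = 2 ^ n * ∫⁻ x in E, (∫⁻ y in Ω, {y | dist x y ≤ d y}.indicator k y) ∂μ :=
        lintegral_const_mul' _ _ (by simp)
    _ = 2 ^ n * ∫⁻ y in Ω, k y * μ.restrict E (closedBall y (d y)) := by
        rw [lintegral_measure_closedBall_swap _ _ hdc hkm]
    _ ≤ 2 ^ n * ∫⁻ y in Ω, c * (k y * ν.restrict Ω (closedBall y (3 * d y))) := by
        gcongr 2 ^ n * ?_
        refine setLIntegral_mono' hΩm fun y hy => ?_
        have hdy : 0 < d y := whitneyRadius_pos hΩ hne hy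
        rw [mul_left_comm]
        gcongr
        rw [Measure.restrict_apply measurableSet_closedBall, inter_comm,
          Measure.restrict_eq_self ν]
        · exact h y hy
        · intro z hz
          refine mem_of_dist_lt_whitneyRadius (x := y) ?_
          rw [mem_closedBall, dist_comm] at hz
          rw [← hd]
          linarith
    _ = 2 ^ n * (c * ∫⁻ z in Ω, (∫⁻ y in Ω, {y | dist z y ≤ 3 * d y}.indicator k y) ∂ν) := by
        rw [lintegral_const_mul' _ _ hc,
          lintegral_measure_closedBall_swap _ _ (hdc.const_mul 3) hkm]
    _ ≤ 2 ^ n * (c * ∫⁻ z in Ω, 20 ^ n ∂ν) := by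
        gcongr 2 ^ n * (c * ?_)
        exact setLIntegral_mono' hΩm up
    _ = 40 ^ n * c * ν Ω := by
        rw [lintegral_const, Measure.restrict_apply_univ,
          show (40 : ℝ≥0∞) = 2 * 20 by norm_num, mul_pow]
        ring

/-- The union of the balls on which the average of `g` exceeds `τ`. -/
def superlevel {n : ℕ} (g : (Fin n → ℝ) → ℝ≥0∞) (τ : ℝ≥0∞) : Set (Fin n → ℝ) :=
  ⋃ b ∈ {b : (Fin n → ℝ) × ℝ | 0 < b.2 ∧
    τ * volume (closedBall b.1 b.2) < ∫⁻ y in closedBall b.1 b.2, g y}, ball b.1 b.2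

lemma mem_superlevel {n : ℕ} {g : (Fin n → ℝ) → ℝ≥0∞} {τ : ℝ≥0∞} {y : Fin n → ℝ} :
    y ∈ superlevel g τ ↔ ∃ x r, 0 < r ∧
      τ * volume (closedBall x r) < ∫⁻ y in closedBall x r, g y ∧ y ∈ ball x r := by
  simp [superlevel, and_assoc]

lemma isOpen_superlevel {n : ℕ} (g : (Fin n → ℝ) → ℝ≥0∞) (τ : ℝ≥0∞) :
    IsOpen (superlevel g τ) :=
  isOpen_biUnion fun _ _ => isOpen_ball

lemma volume_closedBall_mul {n : ℕ} (x y : Fin n → ℝ) {c r : ℝ} (hc : 0 ≤ c) (hr : 0 ≤ r) :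
    volume (closedBall x (c * r)) = ENNReal.ofReal c ^ n * volume (closedBall y r) := by
  rw [volume_closedBall_fin x (by positivity), volume_closedBall_fin y hr, mul_left_comm,
    ENNReal.ofReal_mul hc, mul_pow]

lemma mul_volume_superlevel_le {n : ℕ} (hn : n ≠ 0) {g : (Fin n → ℝ) → ℝ≥0∞} {τ : ℝ≥0∞}
    (hτ : τ ≠ 0) (hg : ∫⁻ y, g y ≠ ⊤) :
    τ * volume (superlevel g τ) ≤ 5 ^ n * ∫⁻ y, g y := by
  set t := {b : (Fin n → ℝ) × ℝ | 0 < b.2 ∧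
    τ * volume (closedBall b.1 b.2) < ∫⁻ y in closedBall b.1 b.2, g y} with ht
  have hR : ∀ b ∈ t, b.2 ≤ ((∫⁻ y, g y) / τ).toReal + 1 := by
    rintro ⟨x, r⟩ ⟨hr, hb⟩
    simp only at hr hb ⊢
    by_contra! hcon
    have hfin : (∫⁻ y, g y) / τ ≠ ⊤ := ENNReal.div_ne_top hg hτ
    have h0 : 0 ≤ ((∫⁻ y, g y) / τ).toReal := ENNReal.toReal_nonneg
    have h1 : ENNReal.ofReal r ≤ volume (closedBall x r) := by
      rw [volume_closedBall_fin x hr.le]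
      calc ENNReal.ofReal r ≤ ENNReal.ofReal (2 * r) := ENNReal.ofReal_le_ofReal (by linarith)
        _ ≤ ENNReal.ofReal (2 * r) ^ n :=
          le_self_pow (by rw [ENNReal.one_le_ofReal]; linarith) hn
    have h2 : volume (closedBall x r) ≤ (∫⁻ y, g y) / τ := by
      rw [ENNReal.le_div_iff_mul_le (Or.inl hτ) (Or.inr hg), mul_comm]
      exact hb.le.trans (setLIntegral_le_lintegral _ _)
    have h3 := (ENNReal.ofReal_le_iff_le_toReal hfin).1 (h1.trans h2)
    linarith
  obtain ⟨u, hut, hdisj, hcov⟩ := Vitali.exists_disjoint_subfamily_covering_enlargement_closedBall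
    t (fun b => b.1) (fun b => b.2) _ hR 5 (by norm_num)
  have hu : u.Countable := by
    refine hdisj.countable_of_nonempty_interior fun b hb => ?_
    exact (nonempty_ball.2 (hut hb).1).mono ball_subset_interior_closedBall
  have hsub : superlevel g τ ⊆ ⋃ b ∈ u, closedBall b.1 (5 * b.2) := by
    refine iUnion₂_subset fun b hb => ?_
    obtain ⟨b', hb', hs⟩ := hcov b hb
    exact ball_subset_closedBall.trans (hs.trans (subset_biUnion_of_mem (u := fun b =>
      closedBall b.1 (5 * b.2)) hb'))
  calc τ * volume (superlevel g τ)
      ≤ τ * ∑' b : u, volume (closedBall b.1.1 (5 * b.1.2)) := by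
        gcongr
        exact (measure_mono hsub).trans (measure_biUnion_le _ hu _)
    _ = 5 ^ n * ∑' b : u, τ * volume (closedBall b.1.1 b.1.2) := by
        rw [ENNReal.tsum_mul_left, mul_left_comm, ← ENNReal.tsum_mul_left (a := 5 ^ n)]
        congr 2
        ext b
        rw [volume_closedBall_mul _ b.1.1 (by norm_num) (hut b.2).1.le, ENNReal.ofReal_ofNat]
    _ ≤ 5 ^ n * ∑' b : u, ∫⁻ y in closedBall b.1.1 b.1.2, g y := by
        gcongr with b
        exact (hut b.2).2.le
    _ = 5 ^ n * ∫⁻ y in ⋃ b ∈ u, closedBall b.1 b.2, g y := by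
        rw [lintegral_biUnion hu (fun _ _ => measurableSet_closedBall) hdisj]
    _ ≤ 5 ^ n * ∫⁻ y, g y := by
        gcongr
        exact Measure.restrict_le_self

lemma compl_nonempty_of_volume_ne_top {n : ℕ} (hn : n ≠ 0) {Ω : Set (Fin n → ℝ)}
    (h : volume Ω ≠ ⊤) : Ωᶜ.Nonempty := by
  rw [nonempty_compl]
  rintro rfl
  have : Nonempty (Fin n) := ⟨⟨0, Nat.pos_of_ne_zero hn⟩⟩
  exact h (measure_univ_of_isAddLeftInvariant _)

lemma volume_superlevel_ne_top {n : ℕ} (hn : n ≠ 0) {g : (Fin n → ℝ) → ℝ≥0∞} {τ : ℝ≥0∞}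
    (hτ : τ ≠ 0) (hg : ∫⁻ y, g y ≠ ⊤) : volume (superlevel g τ) ≠ ⊤ := by
  intro h
  have h1 := mul_volume_superlevel_le hn hτ hg
  rw [h, ENNReal.mul_top hτ, top_le_iff] at h1
  exact ENNReal.mul_ne_top (by simp) hg h1

lemma ae_mem_superlevel {n : ℕ} {g : (Fin n → ℝ) → ℝ≥0∞} {τ : ℝ≥0∞} (hgm : AEMeasurable g)
    (hg : ∫⁻ y, g y ≠ ⊤) : ∀ᵐ x, τ < g x → x ∈ superlevel g τ := by
  filter_upwards [(Besicovitch.vitaliFamily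
    (volume : Measure (Fin n → ℝ))).ae_tendsto_lintegral_div hgm hg] with x hx hlt
  have h1 := hx.comp (Besicovitch.tendsto_filterAt volume x)
  obtain ⟨r, hr, hr0⟩ := ((h1.eventually (lt_mem_nhds hlt)).and self_mem_nhdsWithin).exists
  have hr0 : 0 < r := hr0
  rw [mem_superlevel]
  refine ⟨x, r, hr0, ?_, mem_ball_self hr0⟩
  have hv : volume (closedBall x r) ≠ ⊤ := measure_closedBall_lt_top.ne
  have hv0 : volume (closedBall x r) ≠ 0 := (measure_closedBall_pos _ _ hr0).ne'
  exact (ENNReal.lt_div_iff_mul_lt (Or.inl hv0) (Or.inl hv)).1 hr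

lemma setLIntegral_le_of_mem_superlevel {n : ℕ} {g : (Fin n → ℝ) → ℝ≥0∞} {τ : ℝ≥0∞}
    (hne : (superlevel g τ)ᶜ.Nonempty) {y : Fin n → ℝ} (hy : y ∈ superlevel g τ) :
    ∫⁻ z in closedBall y (whitneyRadius (superlevel g τ) y), g z ≤
      9 ^ n * τ * volume (closedBall y (whitneyRadius (superlevel g τ) y)) := by
  have hpos := whitneyRadius_pos (isOpen_superlevel g τ) hne hy
  obtain ⟨z, hz, hdist⟩ := (isOpen_superlevel g τ).isClosed_compl.exists_infDist_eq_dist hne y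
  set d := whitneyRadius (superlevel g τ) y with hd
  have hd8 : dist y z = 8 * d := by rw [← hdist, hd, whitneyRadius]; ring
  have h1 : ∫⁻ w in closedBall z (9 * d), g w ≤ τ * volume (closedBall z (9 * d)) := by
    by_contra! hcon
    exact hz (mem_superlevel.2 ⟨z, 9 * d, by positivity, hcon, mem_ball_self (by positivity)⟩)
  calc ∫⁻ w in closedBall y d, g w ≤ ∫⁻ w in closedBall z (9 * d), g w :=
        lintegral_mono_set (closedBall_subset_closedBall' (by linarith))
    _ ≤ τ * volume (closedBall z (9 * d)) := h1
    _ = _ := by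
        rw [volume_closedBall_mul z y (by norm_num) hpos.le, ENNReal.ofReal_ofNat]
        ring

lemma superlevel_subset_closedBall {n : ℕ} {g : (Fin n → ℝ) → ℝ≥0∞} {τ : ℝ≥0∞}
    {x : Fin n → ℝ} {R : ℝ} (hsupp : ∀ y ∉ closedBall x R, g y = 0)
    (hle : 16 ^ n * ∫⁻ y, g y ≤ τ * volume (closedBall x R)) :
    superlevel g τ ⊆ closedBall x (9 / 8 * R) := by
  intro y hy
  obtain ⟨c, r, hr, hlt, hy⟩ := mem_superlevel.1 hy
  have hrR : r < 1 / 16 * R := by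
    by_contra! hcon
    have h1 : volume (closedBall x R) ≤ 16 ^ n * volume (closedBall c r) := by
      rw [← ENNReal.ofReal_ofNat 16, ← volume_closedBall_mul x c (by norm_num) hr.le]
      exact measure_mono (closedBall_subset_closedBall (by linarith))
    have h2 : 16 ^ n * ∫⁻ y, g y ≤ 16 ^ n * (τ * volume (closedBall c r)) := by
      calc _ ≤ _ := hle
        _ ≤ τ * (16 ^ n * volume (closedBall c r)) := by gcongr
        _ = _ := by ring
    rw [ENNReal.mul_le_mul_iff_right (by simp) (by simp)] at h2
    exact absurd (hlt.trans_le (setLIntegral_le_lintegral _ _)) h2.not_gt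
  have hmeet : ∃ z ∈ closedBall c r, z ∈ closedBall x R := by
    by_contra! hcon
    have : ∫⁻ y in closedBall c r, g y = 0 := by
      rw [setLIntegral_congr_fun measurableSet_closedBall
        (fun z hz => hsupp z (hcon z hz)), lintegral_zero]
    rw [this] at hlt
    exact absurd hlt _root_.not_lt_zero
  obtain ⟨z, hz1, hz2⟩ := hmeet
  rw [mem_closedBall] at hz1 hz2 ⊢
  rw [mem_ball] at hy
  have h1 := dist_triangle y c x
  have h2 := dist_triangle c z x
  rw [dist_comm c z] at h2
  linarith

lemma radius_le_of_volume_closedBall_le {n : ℕ} (hn : n ≠ 0) {x y : Fin n → ℝ} {r s : ℝ}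
    (hr : 0 ≤ r) (hs : 0 ≤ s) (h : volume (closedBall x r) ≤ volume (closedBall y s)) :
    r ≤ s := by
  rw [volume_closedBall_fin x hr, volume_closedBall_fin y hs,
    ← ENNReal.ofReal_pow (by positivity), ← ENNReal.ofReal_pow (by positivity),
    ENNReal.ofReal_le_ofReal_iff (by positivity),
    pow_le_pow_iff_left₀ (by positivity) (by positivity) hn] at h
  linarith

lemma ofReal_abs_average_sub_le {n : ℕ} {f : (Fin n → ℝ) → ℝ} (hf : LocallyIntegrable f)
    {x : Fin n → ℝ} {r : ℝ} (hr : 0 < r) (a : ℝ) {t : ℝ≥0∞}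
    (h : ∫⁻ y in closedBall x r, ENNReal.ofReal |f y - a| ≤ t * volume (closedBall x r)) :
    ENNReal.ofReal |(⨍ y in closedBall x r, f y) - a| ≤ t := by
  have hv : volume (closedBall x r) ≠ ⊤ := measure_closedBall_lt_top.ne
  have hv0 : volume (closedBall x r) ≠ 0 := (measure_closedBall_pos _ _ hr).ne'
  have hint : IntegrableOn f (closedBall x r) := hf.integrableOn_isCompact
    (isCompact_closedBall x r)
  have hprob : IsProbabilityMeasure ((volume.restrict (closedBall x r) univ)⁻¹ •
      volume.restrict (closedBall x r)) := by
    have : NeZero (volume.restrict (closedBall x r)) := ⟨by simpa using hv0⟩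
    have : IsFiniteMeasure (volume.restrict (closedBall x r)) := ⟨by simpa using hv.lt_top⟩
    infer_instance
  have h1 : (⨍ y in closedBall x r, f y) - a = ⨍ y in closedBall x r, (f y - a) := by
    unfold average
    rw [integral_sub _ (integrable_const a)]
    · rw [integral_const, probReal_univ, one_smul]
    · refine hint.smul_measure ?_
      simpa using hv0
  rw [h1, ← Real.enorm_eq_ofReal_abs]
  refine (enorm_integral_le_lintegral_enorm _).trans ?_
  rw [lintegral_smul_measure, Measure.restrict_apply_univ, smul_eq_mul, mul_comm,
    ← div_eq_mul_inv, ENNReal.div_le_iff hv0 hv]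
  simpa only [Real.enorm_eq_ofReal_abs] using h

/-- The multiple of the `BMO` norm by which the level increases in `john_nirenberg`. -/
def johnNirenbergStep (n : ℕ) : ℝ := 9 ^ n * (4 * 800 ^ n)

lemma lintegral_double_sub_average_le {n : ℕ} {f : (Fin n → ℝ) → ℝ}
    (hf : LocallyIntegrable f) {b : ℝ≥0∞}
    (h : ∀ x r, 0 < r → ∫⁻ y in closedBall x r, ENNReal.ofReal |f y - ⨍ z in closedBall x r, f z| ≤
      b * volume (closedBall x r)) (x : Fin n → ℝ) {r : ℝ} (hr : 0 < r) :
    ∫⁻ y in closedBall x (2 * r), ENNReal.ofReal |f y - ⨍ z in closedBall x r, f z| ≤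
      2 * 4 ^ n * b * volume (closedBall x r) := by
  set a := ⨍ z in closedBall x r, f z with ha
  set a' := ⨍ z in closedBall x (2 * r), f z with ha'
  have hv := volume_closedBall_mul x x zero_le_two hr.le
  rw [ENNReal.ofReal_ofNat] at hv
  have h2 := h x (2 * r) (by positivity)
  rw [hv, ← ha'] at h2
  have h3 : ENNReal.ofReal |a - a'| ≤ b * 2 ^ n := by
    refine ofReal_abs_average_sub_le hf hr a' ?_
    refine (lintegral_mono_set (closedBall_subset_closedBall (by linarith))).trans (h2.trans ?_)
    rw [mul_assoc]
  calc ∫⁻ y in closedBall x (2 * r), ENNReal.ofReal |f y - a|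
      ≤ ∫⁻ y in closedBall x (2 * r), (ENNReal.ofReal |f y - a'| + ENNReal.ofReal |a - a'|) := by
        refine lintegral_mono fun y => ?_
        rw [← ENNReal.ofReal_add (abs_nonneg _) (abs_nonneg _), abs_sub_comm a a']
        refine ENNReal.ofReal_le_ofReal ?_
        have := abs_sub_le (f y) a' a
        linarith
    _ = (∫⁻ y in closedBall x (2 * r), ENNReal.ofReal |f y - a'|) +
          ENNReal.ofReal |a - a'| * volume (closedBall x (2 * r)) := by
        rw [lintegral_add_right _ measurable_const, lintegral_const, Measure.restrict_apply_univ]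
    _ ≤ b * (2 ^ n * volume (closedBall x r)) + b * 2 ^ n * (2 ^ n * volume (closedBall x r)) := by
        rw [hv]
        gcongr
    _ ≤ b * (4 ^ n * volume (closedBall x r)) + b * 2 ^ n * (2 ^ n * volume (closedBall x r)) := by
        gcongr
        norm_num
    _ = _ := by
        rw [show (4 : ℝ≥0∞) = 2 * 2 by norm_num, mul_pow]
        ring

/-- The John–Nirenberg inequality. -/
lemma john_nirenberg {n : ℕ} (hn : n ≠ 0) {f : (Fin n → ℝ) → ℝ} (hfm : Measurable f)
    (hf : LocallyIntegrable f) {B : ℝ} (hB : 0 < B)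
    (h : ∀ x r, 0 < r → ∫⁻ y in closedBall x r, ENNReal.ofReal |f y - ⨍ z in closedBall x r, f z| ≤
      ENNReal.ofReal B * volume (closedBall x r)) (k : ℕ) :
    ∀ (x : Fin n → ℝ) (r : ℝ), 0 < r →
      2 ^ k * volume {y ∈ closedBall x r |
        k * (johnNirenbergStep n * B) < |f y - ⨍ z in closedBall x r, f z|} ≤
      volume (closedBall x r) := by
  induction k with
  | zero =>
    intro x r _
    rw [pow_zero, one_mul]
    exact measure_mono (sep_subset _ _)
  | succ k ih =>
    intro x r hr
    set a := ⨍ z in closedBall x r, f z with ha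
    set b := ENNReal.ofReal B with hb
    have hb0 : b ≠ 0 := by simpa [hb] using hB
    have hbt : b ≠ ⊤ := ENNReal.ofReal_ne_top
    have hv : volume (closedBall x r) ≠ ⊤ := measure_closedBall_lt_top.ne
    set g : (Fin n → ℝ) → ℝ≥0∞ := (closedBall x (2 * r)).indicator
      (fun y => ENNReal.ofReal |f y - a|) with hg
    have hgm : Measurable g := Measurable.indicator (by fun_prop) measurableSet_closedBall
    have hgi : ∫⁻ y, g y ≤ 2 * 4 ^ n * b * volume (closedBall x r) := by
      rw [hg, lintegral_indicator measurableSet_closedBall]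
      exact lintegral_double_sub_average_le hf h x hr
    have hgt : ∫⁻ y, g y ≠ ⊤ := ne_top_of_le_ne_top (by finiteness) hgi
    set τ : ℝ≥0∞ := 4 * 800 ^ n * b with hτ
    have hτ0 : τ ≠ 0 := by simp [hτ, hb0]
    have hτt : τ ≠ ⊤ := by finiteness
    set Ω := superlevel g τ with hΩ
    have hΩvol : 2 * 40 ^ n * volume Ω ≤ volume (closedBall x r) := by
      have h1 := (mul_volume_superlevel_le hn hτ0 hgt).trans (mul_le_mul_right hgi (5 ^ n))
      have h2 : (2 * 20 ^ n * b) * (2 * 40 ^ n * volume Ω) ≤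
          (2 * 20 ^ n * b) * volume (closedBall x r) := by
        calc _ = τ * volume Ω := by
              rw [hτ, show (800 : ℝ≥0∞) = 20 * 40 by norm_num, mul_pow]
              ring
          _ ≤ _ := h1
          _ = _ := by
              rw [show (20 : ℝ≥0∞) = 4 * 5 by norm_num, mul_pow]
              ring
      rwa [ENNReal.mul_le_mul_iff_right (by simp [hb0]) (by finiteness)] at h2
    have hne : Ωᶜ.Nonempty :=
      compl_nonempty_of_volume_ne_top hn (volume_superlevel_ne_top hn hτ0 hgt)
    have hΩle : volume Ω ≤ volume (closedBall x r) := by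
      refine le_trans (le_mul_of_one_le_left zero_le ?_) hΩvol
      calc (1 : ℝ≥0∞) ≤ 2 * 1 := by norm_num
        _ ≤ _ := by gcongr; exact one_le_pow₀ (by norm_num)
    set E₀ := {y ∈ closedBall x r |
      ((k + 1 : ℕ) : ℝ) * (johnNirenbergStep n * B) < |f y - a|} with hE₀
    have hE₀m : MeasurableSet E₀ := measurableSet_closedBall.inter
      (measurableSet_lt measurable_const (by fun_prop : Measurable fun y => |f y - a|))
    have hstep : 4 * 800 ^ n * B ≤ johnNirenbergStep n * B := by
      gcongr
      unfold johnNirenbergStep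
      exact le_mul_of_one_le_left (by positivity) (one_le_pow₀ (by norm_num))
    have hE₀Ω : volume E₀ ≤ volume (E₀ ∩ Ω) := by
      refine measure_mono_ae ?_
      filter_upwards [ae_mem_superlevel hgm.aemeasurable hgt (τ := τ)] with y hy hyE
      refine ⟨hyE, hy ?_⟩
      rw [hg, Set.indicator_of_mem (closedBall_subset_closedBall (by linarith) hyE.1)]
      have h1 := hyE.2
      have h2 : τ = ENNReal.ofReal (4 * 800 ^ n * B) := by
        rw [ENNReal.ofReal_mul (by positivity), ENNReal.ofReal_mul (by positivity),
          ENNReal.ofReal_pow (by positivity)]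
        simp [hτ, hb]
      rw [h2, ENNReal.ofReal_lt_ofReal_iff_of_nonneg (by positivity)]
      push_cast at h1
      have h3 : 0 ≤ (k : ℝ) * (johnNirenbergStep n * B) := by
        unfold johnNirenbergStep; positivity
      linarith
    have main := measure_le_of_whitney (isOpen_superlevel g τ) hne volume volume
      (hE₀m.inter (isOpen_superlevel g τ).measurableSet) inter_subset_right
      (c := (2 ^ k)⁻¹) (by simp) ?_
    · calc 2 ^ (k + 1) * volume E₀ ≤ 2 ^ (k + 1) * (40 ^ n * (2 ^ k)⁻¹ * volume Ω) := by
            gcongr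
            exact hE₀Ω.trans main
        _ = (2 ^ k * (2 ^ k)⁻¹) * (2 * 40 ^ n * volume Ω) := by ring
        _ ≤ volume (closedBall x r) := by
            rwa [ENNReal.mul_inv_cancel (by simp) (by simp), one_mul]
    intro y hy
    set d := whitneyRadius (superlevel g τ) y with hd
    have hdpos : 0 < d := whitneyRadius_pos (isOpen_superlevel g τ) hne hy
    rcases (E₀ ∩ superlevel g τ ∩ closedBall y d).eq_empty_or_nonempty with hemp | ⟨z, hz⟩
    · rw [hemp, measure_empty]
      exact zero_le
    have h4d : 4 * d ≤ r := by
      refine radius_le_of_volume_closedBall_le hn (x := y) (y := x) (by positivity) hr.le ?_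
      refine le_trans (measure_mono fun u hu => ?_) hΩle
      refine mem_of_dist_lt_whitneyRadius (x := y) ?_
      rw [mem_closedBall, dist_comm] at hu
      rw [← hd]
      linarith
    have hsub : closedBall y d ⊆ closedBall x (2 * r) := by
      refine closedBall_subset_closedBall' ?_
      have h1 := hz.1.1.1
      have h2 := hz.2
      rw [mem_closedBall] at h1 h2
      have h3 := dist_triangle_left y x z
      linarith
    have havg : ENNReal.ofReal |(⨍ u in closedBall y d, f u) - a| ≤ 9 ^ n * τ := by
      refine ofReal_abs_average_sub_le hf hdpos a ?_
      rw [← setLIntegral_congr_fun (f := g) measurableSet_closedBall fun u hu => by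
        rw [hg, Set.indicator_of_mem (hsub hu)]]
      exact setLIntegral_le_of_mem_superlevel hne hy
    have havg' : |(⨍ u in closedBall y d, f u) - a| ≤ johnNirenbergStep n * B := by
      have h1 : 9 ^ n * τ = ENNReal.ofReal (johnNirenbergStep n * B) := by
        rw [johnNirenbergStep, ENNReal.ofReal_mul (by positivity),
          ENNReal.ofReal_mul (by positivity), ENNReal.ofReal_mul (by positivity),
          ENNReal.ofReal_pow (by positivity), ENNReal.ofReal_pow (by positivity)]
        simp [hτ, hb, mul_assoc]
      rw [h1] at havg
      refine (ENNReal.ofReal_le_ofReal_iff ?_).1 havg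
      unfold johnNirenbergStep
      positivity
    rw [← ENNReal.div_eq_inv_mul, ENNReal.le_div_iff_mul_le (by simp) (by simp), mul_comm]
    refine le_trans ?_ ((ih y d hdpos).trans
      (measure_mono (closedBall_subset_closedBall (by linarith))))
    gcongr 2 ^ k * ?_
    refine measure_mono fun u hu => ⟨hu.2, ?_⟩
    have h1 := hu.1.1.2
    push_cast at h1
    have h2 := abs_sub_le (f u) (⨍ v in closedBall y d, f v) a
    linarith

/-- The uncentered maximal function over cubes of a function valued in `ℝ≥0∞`. -/
def cubeMaximal {n : ℕ} (g : (Fin n → ℝ) → ℝ≥0∞) (y : Fin n → ℝ) : ℝ≥0∞ :=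
  ⨆ (c : Fin n → ℝ) (ρ : ℝ) (_ : 0 < ρ) (_ : y ∈ closedBall c ρ),
    (∫⁻ z in closedBall c ρ, g z) / volume (closedBall c ρ)

lemma le_cubeMaximal {n : ℕ} (g : (Fin n → ℝ) → ℝ≥0∞) {y c : Fin n → ℝ} {ρ : ℝ} (hρ : 0 < ρ)
    (hy : y ∈ closedBall c ρ) :
    (∫⁻ z in closedBall c ρ, g z) / volume (closedBall c ρ) ≤ cubeMaximal g y :=
  le_iSup_of_le c (le_iSup_of_le ρ (le_iSup_of_le hρ (le_iSup_of_le hy le_rfl)))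

lemma cubeMaximal_mono {n : ℕ} {g g' : (Fin n → ℝ) → ℝ≥0∞} (h : g ≤ g') (y : Fin n → ℝ) :
    cubeMaximal g y ≤ cubeMaximal g' y := by
  unfold cubeMaximal
  gcongr
  exact h _

lemma le_cubeMaximal_of_mem_superlevel {n : ℕ} {g : (Fin n → ℝ) → ℝ≥0∞} {τ : ℝ≥0∞}
    {y : Fin n → ℝ} (hy : y ∈ superlevel g τ) : τ ≤ cubeMaximal g y := by
  obtain ⟨c, r, hr, hlt, hyc⟩ := mem_superlevel.1 hy
  refine le_trans ?_ (le_cubeMaximal g hr (ball_subset_closedBall hyc))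
  rw [ENNReal.le_div_iff_mul_le (Or.inl (measure_closedBall_pos _ _ hr).ne')
    (Or.inl measure_closedBall_lt_top.ne)]
  exact hlt.le

lemma sum_indicator_superlevel_le {n : ℕ} (g : (Fin n → ℝ) → ℝ≥0∞) (m : ℝ≥0∞) (J : ℕ)
    (y : Fin n → ℝ) :
    ∑ j ∈ Finset.range J, (superlevel g (2 ^ (j + 1) * m)).indicator (fun _ => 2 ^ j * m) y ≤
      cubeMaximal g y := by
  have geom : ∀ J : ℕ, ∑ j ∈ Finset.range J, (2 ^ j * m : ℝ≥0∞) ≤ 2 ^ J * m := by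
    intro J
    induction J with
    | zero => simp
    | succ J ih =>
      rw [Finset.sum_range_succ, pow_succ, mul_two, add_mul]
      gcongr
  induction J with
  | zero => simp
  | succ J ih =>
    by_cases hy : y ∈ superlevel g (2 ^ (J + 1) * m)
    · refine le_trans ?_ (le_cubeMaximal_of_mem_superlevel hy)
      refine le_trans (Finset.sum_le_sum fun j _ => ?_) (geom (J + 1))
      exact Set.indicator_le_self _ _ _
    · rw [Finset.sum_range_succ, Set.indicator_of_notMem hy, add_zero]
      exact ih

/-- A logarithmic gain of integrability from a bound on the maximal function. -/
lemma nat_mul_setLIntegral_superlevel_le {n : ℕ} (hn : n ≠ 0) {W : (Fin n → ℝ) → ℝ≥0∞}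
    (hW : Measurable W) {x : Fin n → ℝ} {r : ℝ} (hr : 0 < r)
    (hfin : ∫⁻ y in closedBall x r, W y ≠ ⊤)
    {m : ℝ≥0∞} (hm0 : m ≠ 0) (hmt : m ≠ ⊤)
    (hm : 16 ^ n * ∫⁻ y in closedBall x r, W y ≤ m * volume (closedBall x r)) (J : ℕ) :
    J * ∫⁻ y in closedBall x r ∩ {y | 2 ^ J * m < W y}, W y ≤
      2 * 360 ^ n * ∫⁻ y in closedBall x (9 / 8 * r),
        cubeMaximal ((closedBall x (9 / 8 * r)).indicator W) y := by
  set R := closedBall x r with hR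
  set R' := closedBall x (9 / 8 * r) with hR'
  set g := R.indicator W with hg
  have hgm : Measurable g := hW.indicator measurableSet_closedBall
  have hgi : ∫⁻ y, g y = ∫⁻ y in R, W y := lintegral_indicator measurableSet_closedBall _
  have hgt : ∫⁻ y, g y ≠ ⊤ := hgi ▸ hfin
  set Ω : ℕ → Set (Fin n → ℝ) := fun j => superlevel g (2 ^ (j + 1) * m) with hΩ
  have hΩo : ∀ j, IsOpen (Ω j) := fun j => isOpen_superlevel _ _
  have hτ0 : ∀ j : ℕ, (2 ^ (j + 1) * m : ℝ≥0∞) ≠ 0 := fun j => by simp [hm0]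
  have hΩR : ∀ j, Ω j ⊆ R' := fun j => by
    refine superlevel_subset_closedBall (fun y hy => Set.indicator_of_notMem hy _) ?_
    rw [hgi]
    refine hm.trans ?_
    gcongr
    exact le_mul_of_one_le_left zero_le (one_le_pow₀ one_le_two)
  have : IsFiniteMeasure (volume.withDensity g) := isFiniteMeasure_withDensity hgt
  set T := R ∩ {y | 2 ^ J * m < W y} with hT
  have hTm : MeasurableSet T := measurableSet_closedBall.inter
    (measurableSet_lt measurable_const hW)
  have hTg : ∫⁻ y in T, W y = volume.withDensity g T := by
    rw [withDensity_apply _ hTm]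
    exact setLIntegral_congr_fun hTm fun y hy => (Set.indicator_of_mem hy.1 W).symm
  have level : ∀ j ∈ Finset.range J, volume.withDensity g T ≤
      2 * 360 ^ n * (2 ^ j * m * volume (Ω j)) := by
    intro j hj
    rw [Finset.mem_range] at hj
    have hne : (Ω j)ᶜ.Nonempty :=
      compl_nonempty_of_volume_ne_top hn (volume_superlevel_ne_top hn (hτ0 j) hgt)
    have h1 : volume.withDensity g T ≤ volume.withDensity g (T ∩ Ω j) := by
      refine measure_mono_ae ?_
      filter_upwards [(withDensity_absolutelyContinuous volume g).ae_le
        (ae_mem_superlevel hgm.aemeasurable hgt (τ := 2 ^ (j + 1) * m))] with y hy hyT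
      refine ⟨hyT, hy ?_⟩
      rw [hg, Set.indicator_of_mem hyT.1]
      refine lt_of_le_of_lt ?_ hyT.2
      gcongr
      · exact one_le_two
      · exact hj
    refine h1.trans ((measure_le_of_whitney (hΩo j) hne (volume.withDensity g) volume
      (hTm.inter (hΩo j).measurableSet) inter_subset_right
      (c := 9 ^ n * (2 ^ (j + 1) * m)) (by finiteness) ?_).trans_eq ?_)
    · intro y hy
      have hpos := whitneyRadius_pos (hΩo j) hne hy
      refine (measure_mono inter_subset_right).trans ?_
      rw [withDensity_apply _ measurableSet_closedBall]
      refine (setLIntegral_le_of_mem_superlevel hne hy).trans ?_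
      gcongr
      linarith
    · rw [show (360 : ℝ≥0∞) = 40 * 9 by norm_num, mul_pow]
      ring
  calc (J : ℝ≥0∞) * ∫⁻ y in T, W y
      = ∑ j ∈ Finset.range J, volume.withDensity g T := by
        rw [hTg, Finset.sum_const, Finset.card_range, nsmul_eq_mul]
    _ ≤ ∑ j ∈ Finset.range J, 2 * 360 ^ n * (2 ^ j * m * volume (Ω j)) :=
        Finset.sum_le_sum level
    _ = 2 * 360 ^ n * ∑ j ∈ Finset.range J,
          ∫⁻ y in R', (Ω j).indicator (fun _ => 2 ^ j * m) y := by
        rw [Finset.mul_sum]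
        refine Finset.sum_congr rfl fun j _ => ?_
        rw [lintegral_indicator (hΩo j).measurableSet, lintegral_const,
          Measure.restrict_apply_univ, Measure.restrict_eq_self _ (hΩR j)]
    _ = 2 * 360 ^ n * ∫⁻ y in R',
          ∑ j ∈ Finset.range J, (Ω j).indicator (fun _ => 2 ^ j * m) y := by
        rw [lintegral_finsetSum]
        exact fun j _ => measurable_const.indicator (hΩo j).measurableSet
    _ ≤ _ := by
        gcongr with y
        refine (sum_indicator_superlevel_le g m J y).trans (cubeMaximal_mono ?_ y)
        exact indicator_le_indicator_of_subset (closedBall_subset_closedBall (by linarith))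
          (fun _ => zero_le)

/-- A small portion of a cube carries a small portion of a weak `A∞` weight. -/
lemma nat_mul_withDensity_le {n : ℕ} (hn : n ≠ 0) {W : (Fin n → ℝ) → ℝ≥0∞} (hW : Measurable W)
    (hfin : ∀ x r, ∫⁻ y in closedBall x r, W y ≠ ⊤) {K : ℝ≥0∞} (hK0 : K ≠ 0) (hKt : K ≠ ⊤)
    (hK : ∀ x r, 0 < r → ∫⁻ y in closedBall x r, cubeMaximal ((closedBall x r).indicator W) y ≤
      K * volume.withDensity W (closedBall x (2 * r)))
    {N J : ℕ} (hJ : 4 * 360 ^ n * K * N ≤ J) {x : Fin n → ℝ} {r : ℝ} (hr : 0 < r)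
    {F : Set (Fin n → ℝ)} (hF : MeasurableSet F) (hFR : F ⊆ closedBall x r)
    (hvol : 2 * N * 16 ^ n * 2 ^ J * volume F ≤ volume (closedBall x r)) :
    N * volume.withDensity W F ≤ volume.withDensity W (closedBall x (9 / 4 * r)) := by
  set μ := volume.withDensity W with hμ
  set R := closedBall x r with hR
  have hRm : MeasurableSet R := measurableSet_closedBall
  have hμR : μ R = ∫⁻ y in R, W y := withDensity_apply _ hRm
  rcases eq_or_ne (μ R) 0 with h0 | h0
  · rw [measure_mono_null hFR h0, mul_zero]
    exact zero_le
  have hv : volume R ≠ ⊤ := measure_closedBall_lt_top.ne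
  have hv0 : volume R ≠ 0 := (measure_closedBall_pos _ _ hr).ne'
  have hμRt : μ R ≠ ⊤ := hμR ▸ hfin x r
  set m := 16 ^ n * μ R / volume R with hm
  have hmR : m * volume R = 16 ^ n * μ R := ENNReal.div_mul_cancel hv0 hv
  have hm0 : m ≠ 0 := by simp [hm, h0, hv]
  have hmt : m ≠ ⊤ := ENNReal.div_ne_top (by finiteness) hv0
  set T := R ∩ {y | 2 ^ J * m < W y} with hT
  have hTm : MeasurableSet T := hRm.inter (measurableSet_lt measurable_const hW)
  have h1 : μ F ≤ 2 ^ J * m * volume F + μ T := by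
    calc μ F ≤ μ (F \ T) + μ T := by
          refine (measure_mono ?_).trans (measure_union_le _ _)
          intro y hy
          by_cases hyT : y ∈ T
          · exact Or.inr hyT
          · exact Or.inl ⟨hy, hyT⟩
      _ ≤ 2 ^ J * m * volume F + μ T := by
          gcongr
          rw [hμ, withDensity_apply _ (hF.diff hTm)]
          calc ∫⁻ y in F \ T, W y ≤ ∫⁻ y in F \ T, 2 ^ J * m := by
                refine setLIntegral_mono' (hF.diff hTm) fun y hy => ?_
                by_contra! hcon
                exact hy.2 ⟨hFR hy.1, hcon⟩
            _ = 2 ^ J * m * volume (F \ T) := by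
                rw [lintegral_const, Measure.restrict_apply_univ]
            _ ≤ _ := by
                gcongr
                exact sdiff_subset
  have hsmall : 2 * N * (2 ^ J * m * volume F) ≤ μ R := by
    have : volume R * (2 * N * (2 ^ J * m * volume F)) ≤ volume R * μ R := by
      calc _ = m * volume R * (2 * N * 2 ^ J * volume F) := by ring
        _ = μ R * (2 * N * 16 ^ n * 2 ^ J * volume F) := by rw [hmR]; ring
        _ ≤ μ R * volume R := by gcongr
        _ = _ := mul_comm _ _
    rwa [ENNReal.mul_le_mul_iff_right hv0 hv] at this
  have hlog : 2 * N * μ T ≤ μ (closedBall x (9 / 4 * r)) := by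
    have h2 := nat_mul_setLIntegral_superlevel_le hn hW hr (hfin x r) hm0 hmt
      (by rw [← hμR, hmR]) J
    rw [← withDensity_apply _ hTm] at h2
    have h3 := hK x (9 / 8 * r) (by positivity)
    rw [show 2 * (9 / 8 * r) = 9 / 4 * r by ring] at h3
    have : (2 * 360 ^ n * K) * (2 * N * μ T) ≤
        (2 * 360 ^ n * K) * μ (closedBall x (9 / 4 * r)) := by
      calc _ = 4 * 360 ^ n * K * N * μ T := by ring
        _ ≤ J * μ T := by gcongr
        _ ≤ _ := h2
        _ ≤ 2 * 360 ^ n * (K * μ (closedBall x (9 / 4 * r))) := by gcongr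
        _ = _ := by ring
    rwa [ENNReal.mul_le_mul_iff_right (by simp [hK0]) (by finiteness)] at this
  have hmono : μ R ≤ μ (closedBall x (9 / 4 * r)) :=
    measure_mono (closedBall_subset_closedBall (by linarith))
  have : 2 * (N * μ F) ≤ 2 * μ (closedBall x (9 / 4 * r)) := by
    calc 2 * (N * μ F) ≤ 2 * (N * (2 ^ J * m * volume F + μ T)) := by gcongr
      _ = 2 * N * (2 ^ J * m * volume F) + 2 * N * μ T := by ring
      _ ≤ μ (closedBall x (9 / 4 * r)) + μ (closedBall x (9 / 4 * r)) :=
          add_le_add (hsmall.trans hmono) hlog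
      _ = _ := (two_mul _).symm
  rwa [ENNReal.mul_le_mul_iff_right (by simp) (by simp)] at this

/-- The gain in Lebesgue measure at each step of `two_pow_mul_withDensity_le`. -/
def decayRate (n J : ℕ) : ℝ≥0∞ := 144 ^ n * (2 * (2 * 40 ^ n : ℕ) * 16 ^ n * 2 ^ J)

lemma one_le_decayFactor (n J : ℕ) :
    (1 : ℝ≥0∞) ≤ 2 * (2 * 40 ^ n : ℕ) * 16 ^ n * 2 ^ J := by
  exact_mod_cast Nat.one_le_iff_ne_zero.2 (by positivity : 2 * (2 * 40 ^ n) * 16 ^ n * 2 ^ J ≠ 0)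

lemma one_le_decayRate (n J : ℕ) : 1 ≤ decayRate n J :=
  one_le_mul (one_le_pow₀ (by norm_num)) (one_le_decayFactor n J)

lemma decayRate_ne_top (n J : ℕ) : decayRate n J ≠ ⊤ := by
  unfold decayRate
  finiteness

/-- Geometric decay of a weak `A∞` weight, relative to the tripled cube. -/
lemma two_pow_mul_withDensity_le {n : ℕ} (hn : n ≠ 0) {W : (Fin n → ℝ) → ℝ≥0∞}
    (hW : Measurable W)
    (hfin : ∀ x r, ∫⁻ y in closedBall x r, W y ≠ ⊤) {K : ℝ≥0∞} (hK0 : K ≠ 0) (hKt : K ≠ ⊤)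
    (hK : ∀ x r, 0 < r → ∫⁻ y in closedBall x r, cubeMaximal ((closedBall x r).indicator W) y ≤
      K * volume.withDensity W (closedBall x (2 * r)))
    {J : ℕ} (hJ : 4 * 360 ^ n * K * (2 * 40 ^ n : ℕ) ≤ J) (k : ℕ) :
    ∀ (x : Fin n → ℝ) (r : ℝ), 0 < r → ∀ E : Set (Fin n → ℝ), MeasurableSet E →
      E ⊆ closedBall x r → decayRate n J ^ k * volume E ≤ volume (closedBall x r) →
      2 ^ k * volume.withDensity W E ≤ volume.withDensity W (closedBall x (3 * r)) := by
  set μ := volume.withDensity W with hμ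
  set S : ℝ≥0∞ := 2 * (2 * 40 ^ n : ℕ) * 16 ^ n * 2 ^ J with hS
  have hS1 : 1 ≤ S := one_le_decayFactor n J
  set σ := decayRate n J with hσ
  have hσS : σ = 144 ^ n * S := rfl
  have hσ1 : 1 ≤ σ := one_le_decayRate n J
  have hσt : σ ≠ ⊤ := decayRate_ne_top n J
  have hσ0 : σ ≠ 0 := (zero_lt_one.trans_le hσ1).ne'
  induction k with
  | zero =>
    intro x r hr E _ hEQ _
    rw [pow_zero, one_mul]
    exact measure_mono (hEQ.trans (closedBall_subset_closedBall (by linarith)))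
  | succ k ih =>
    intro x r hr E hE hEQ hvol
    have hEt : volume E ≠ ⊤ := ne_top_of_le_ne_top measure_closedBall_lt_top.ne
      (measure_mono hEQ)
    set g : (Fin n → ℝ) → ℝ≥0∞ := E.indicator 1 with hg
    have hgm : Measurable g := measurable_one.indicator hE
    have hgi : ∫⁻ y, g y = volume E := lintegral_indicator_one hE
    have hgt : ∫⁻ y, g y ≠ ⊤ := hgi ▸ hEt
    have hτ' : (9 ^ n * σ ^ k : ℝ≥0∞) ≠ ⊤ := by finiteness
    have hτ'0 : (9 ^ n * σ ^ k : ℝ≥0∞) ≠ 0 := by simp [hσ0]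
    set τ : ℝ≥0∞ := (9 ^ n * σ ^ k)⁻¹ with hτ
    have hτ0 : τ ≠ 0 := ENNReal.inv_ne_zero.2 hτ'
    have hτ1 : τ < 1 := by
      rw [hτ, ENNReal.inv_lt_one]
      calc (1 : ℝ≥0∞) < 9 ^ n := one_lt_pow₀ (by norm_num) hn
        _ ≤ 9 ^ n * σ ^ k := le_mul_of_one_le_right zero_le (one_le_pow₀ hσ1)
    have hττ : τ * (9 ^ n * σ ^ k) = 1 := ENNReal.inv_mul_cancel hτ'0 hτ'
    have hcancel : ∀ {u v : ℝ≥0∞}, τ * u ≤ v → u ≤ 9 ^ n * σ ^ k * v := by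
      intro u v h
      calc u = τ * (9 ^ n * σ ^ k) * u := by rw [hττ, one_mul]
        _ = 9 ^ n * σ ^ k * (τ * u) := by ring
        _ ≤ _ := by gcongr
    have hΩo := isOpen_superlevel g τ
    have hne : (superlevel g τ)ᶜ.Nonempty :=
      compl_nonempty_of_volume_ne_top hn (volume_superlevel_ne_top hn hτ0 hgt)
    have hΩR : superlevel g τ ⊆ closedBall x (9 / 8 * r) := by
      refine superlevel_subset_closedBall
        (fun y hy => Set.indicator_of_notMem (fun h => hy (hEQ h)) _) ?_
      rw [hgi]
      calc 16 ^ n * volume E = τ * (9 ^ n * σ ^ k) * (16 ^ n * volume E) := by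
            rw [hττ, one_mul]
        _ = τ * (144 ^ n * 1 * σ ^ k * volume E) := by
            rw [show (144 : ℝ≥0∞) = 9 * 16 by norm_num, mul_pow]
            ring
        _ ≤ τ * (144 ^ n * S * σ ^ k * volume E) := by gcongr
        _ = τ * (σ ^ (k + 1) * volume E) := by
            rw [← hσS]
            ring
        _ ≤ _ := by gcongr
    have hSΩ : S * volume (superlevel g τ) ≤ volume (closedBall x (9 / 8 * r)) := by
      have h1 := hcancel (mul_volume_superlevel_le hn hτ0 hgt)
      rw [hgi] at h1
      calc S * volume (superlevel g τ) ≤ S * (9 ^ n * σ ^ k * (5 ^ n * volume E)) := by gcongr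
        _ = 45 ^ n * S * σ ^ k * volume E := by
            rw [show (45 : ℝ≥0∞) = 9 * 5 by norm_num, mul_pow]
            ring
        _ ≤ 144 ^ n * S * σ ^ k * volume E := by
            gcongr
            norm_num
        _ = σ ^ (k + 1) * volume E := by
            rw [← hσS]
            ring
        _ ≤ _ := hvol
        _ ≤ _ := measure_mono (closedBall_subset_closedBall (by linarith))
    have hsmall : (2 * 40 ^ n : ℕ) * μ (superlevel g τ) ≤ μ (closedBall x (3 * r)) := by
      refine (nat_mul_withDensity_le hn hW hfin hK0 hKt hK hJ (by positivity)
        hΩo.measurableSet hΩR hSΩ).trans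
        (measure_mono (closedBall_subset_closedBall (by linarith)))
    have hEΩ : μ E ≤ μ (E ∩ superlevel g τ) := by
      refine measure_mono_ae ?_
      filter_upwards [(withDensity_absolutelyContinuous volume W).ae_le
        (ae_mem_superlevel hgm.aemeasurable hgt (τ := τ))] with y hy hyE
      refine ⟨hyE, hy ?_⟩
      rw [hg, Set.indicator_of_mem hyE]
      exact hτ1
    have main := measure_le_of_whitney hΩo hne μ μ (hE.inter hΩo.measurableSet)
      inter_subset_right (c := (2 ^ k)⁻¹) (by simp) ?_
    · calc 2 ^ (k + 1) * μ E ≤ 2 ^ (k + 1) * (40 ^ n * (2 ^ k)⁻¹ * μ (superlevel g τ)) := by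
            gcongr
            exact hEΩ.trans main
        _ = (2 ^ k * (2 ^ k)⁻¹) * ((2 * 40 ^ n : ℕ) * μ (superlevel g τ)) := by
            push_cast
            ring
        _ ≤ _ := by rwa [ENNReal.mul_inv_cancel (by simp) (by simp), one_mul]
    intro y hy
    have hpos := whitneyRadius_pos hΩo hne hy
    rw [← ENNReal.div_eq_inv_mul, ENNReal.le_div_iff_mul_le (by simp) (by simp), mul_comm]
    have h1 := ih y _ hpos (E ∩ closedBall y (whitneyRadius (superlevel g τ) y))
      (hE.inter measurableSet_closedBall) inter_subset_right ?_
    · refine le_trans ?_ h1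
      gcongr
      exact inter_subset_left
    · have h2 := setLIntegral_le_of_mem_superlevel hne hy
      rw [hg, lintegral_indicator_one hE, Measure.restrict_apply hE] at h2
      calc _ ≤ σ ^ k * (9 ^ n * τ * volume (closedBall y (whitneyRadius (superlevel g τ) y))) := by
            gcongr
        _ = τ * (9 ^ n * σ ^ k) *
            volume (closedBall y (whitneyRadius (superlevel g τ) y)) := by ring
        _ = _ := by rw [hττ, one_mul]

/-- Geometric decay of a weak `A∞` weight, relative to the doubled cube. -/
lemma two_pow_mul_withDensity_le_double {n : ℕ} (hn : n ≠ 0) {W : (Fin n → ℝ) → ℝ≥0∞}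
    (hW : Measurable W)
    (hfin : ∀ x r, ∫⁻ y in closedBall x r, W y ≠ ⊤) {K : ℝ≥0∞} (hK0 : K ≠ 0) (hKt : K ≠ ⊤)
    (hK : ∀ x r, 0 < r → ∫⁻ y in closedBall x r, cubeMaximal ((closedBall x r).indicator W) y ≤
      K * volume.withDensity W (closedBall x (2 * r)))
    {J : ℕ} (hJ : 4 * 360 ^ n * K * (2 * 40 ^ n : ℕ) ≤ J) (k : ℕ) {x : Fin n → ℝ} {r : ℝ}
    (hr : 0 < r) {E : Set (Fin n → ℝ)} (hE : MeasurableSet E) (hEQ : E ⊆ closedBall x r)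
    (hvol : 9 ^ n * decayRate n J ^ k * volume E ≤ volume (closedBall x r)) :
    2 ^ k * volume.withDensity W E ≤ 40 ^ n * volume.withDensity W (closedBall x (2 * r)) := by
  set μ := volume.withDensity W with hμ
  set Ω := ball x (2 * r) with hΩ
  have hΩt : volume Ω ≠ ⊤ := measure_ball_lt_top.ne
  have hne : Ωᶜ.Nonempty := compl_nonempty_of_volume_ne_top hn hΩt
  have main := measure_le_of_whitney isOpen_ball hne μ μ hE
    (hEQ.trans (closedBall_subset_ball (by linarith))) (c := (2 ^ k)⁻¹) (by simp) ?_
  · calc 2 ^ k * μ E ≤ 2 ^ k * (40 ^ n * (2 ^ k)⁻¹ * μ Ω) := by gcongr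
      _ = (2 ^ k * (2 ^ k)⁻¹) * (40 ^ n * μ Ω) := by ring
      _ = 40 ^ n * μ Ω := by rw [ENNReal.mul_inv_cancel (by simp) (by simp), one_mul]
      _ ≤ _ := by
          gcongr
          exact ball_subset_closedBall
  intro y hy
  have hpos := whitneyRadius_pos isOpen_ball hne hy
  set d := whitneyRadius Ω y with hd
  rcases (E ∩ closedBall y d).eq_empty_or_nonempty with hemp | ⟨q, hqE, hqy⟩
  · rw [hemp, measure_empty]
    exact zero_le
  have h9d : r ≤ 9 * d := by
    have h1 : r ≤ infDist q Ωᶜ := by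
      rw [le_infDist hne]
      intro z hz
      have h2 := hEQ hqE
      rw [mem_compl_iff, hΩ, mem_ball, not_lt] at hz
      rw [mem_closedBall] at h2
      have := dist_triangle_left z x q
      linarith
    have h3 := whitneyRadius_le Ω q y
    rw [mem_closedBall] at hqy
    have h4 : 8 * whitneyRadius Ω q = infDist q Ωᶜ := by unfold whitneyRadius; ring
    linarith
  rw [← ENNReal.div_eq_inv_mul, ENNReal.le_div_iff_mul_le (by simp) (by simp), mul_comm]
  refine two_pow_mul_withDensity_le hn hW hfin hK0 hKt hK hJ k y d hpos _
    (hE.inter measurableSet_closedBall) inter_subset_right ?_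
  have h5 : 9 ^ n * (decayRate n J ^ k * volume E) ≤ 9 ^ n * volume (closedBall y d) := by
    rw [← mul_assoc, ← ENNReal.ofReal_ofNat 9, ← volume_closedBall_mul x y (by norm_num) hpos.le,
      ENNReal.ofReal_ofNat]
    exact hvol.trans (measure_mono (closedBall_subset_closedBall h9d))
  rw [ENNReal.mul_le_mul_iff_right (by simp) (by simp)] at h5
  refine le_trans ?_ h5
  gcongr
  exact inter_subset_left

lemma measure_closedBall_eq_zero_of_le_double {n : ℕ} (hn : n ≠ 0) (μ : Measure (Fin n → ℝ))
    [SFinite μ] (hfin : ∀ x r, μ (closedBall x r) ≠ ⊤) {K : ℝ≥0∞}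
    (hK : ∀ x r, 0 < r → μ (closedBall x r) ≤ K * μ (closedBall x (2 * r)))
    (hlt : 40 ^ n * K < 1) (x : Fin n → ℝ) (r : ℝ) : μ (closedBall x r) = 0 := by
  set Ω := ball x (r + 1) with hΩ
  have hne : Ωᶜ.Nonempty :=
    compl_nonempty_of_volume_ne_top hn (measure_ball_lt_top (x := x) (r := r + 1)).ne
  have hKt : K ≠ ⊤ := by
    rintro rfl
    simp at hlt
  have h1 : μ Ω ≤ 40 ^ n * K * μ Ω := by
    refine measure_le_of_whitney isOpen_ball hne μ μ isOpen_ball.measurableSet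
      subset_rfl hKt fun y hy => ?_
    have hpos := whitneyRadius_pos isOpen_ball hne hy
    refine (measure_mono inter_subset_right).trans ((hK y _ hpos).trans ?_)
    gcongr
    norm_num
  have hΩt : μ Ω ≠ ⊤ := ne_top_of_le_ne_top (hfin x (r + 1)) (measure_mono ball_subset_closedBall)
  refine measure_mono_null (closedBall_subset_ball (lt_add_one r)) ?_
  by_contra h0
  exact absurd h1 (not_le_of_gt (by
    simpa using (ENNReal.mul_lt_mul_iff_left h0 hΩt).2 hlt))

lemma two_pow_mul_withDensity_oscillation_le {n : ℕ} (hn : n ≠ 0) {f : (Fin n → ℝ) → ℝ}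
    (hfm : Measurable f) (hf : LocallyIntegrable f) {B : ℝ} (hB : 0 < B)
    (h : ∀ x r, 0 < r → ∫⁻ y in closedBall x r,
      ENNReal.ofReal |f y - ⨍ z in closedBall x r, f z| ≤
        ENNReal.ofReal B * volume (closedBall x r))
    {W : (Fin n → ℝ) → ℝ≥0∞} (hW : Measurable W)
    (hfin : ∀ x r, ∫⁻ y in closedBall x r, W y ≠ ⊤) {K : ℝ≥0∞} (hK0 : K ≠ 0) (hKt : K ≠ ⊤)
    (hK : ∀ x r, 0 < r → ∫⁻ y in closedBall x r, cubeMaximal ((closedBall x r).indicator W) y ≤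
      K * volume.withDensity W (closedBall x (2 * r)))
    {J : ℕ} (hJ : 4 * 360 ^ n * K * (2 * 40 ^ n : ℕ) ≤ J) (k : ℕ) {x : Fin n → ℝ} {r : ℝ}
    (hr : 0 < r) :
    2 ^ k * volume.withDensity W {y ∈ closedBall x r |
      k * ((2 + 20 * n + J : ℕ) * (johnNirenbergStep n * B)) <
        |f y - ⨍ z in closedBall x r, f z|} ≤
      40 ^ n * volume.withDensity W (closedBall x (2 * r)) := by
  set j : ℕ := 2 + 20 * n + J with hj
  rcases Nat.eq_zero_or_pos k with rfl | hk
  · rw [pow_zero, one_mul]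
    calc _ ≤ volume.withDensity W (closedBall x (2 * r)) :=
          measure_mono ((sep_subset _ _).trans (closedBall_subset_closedBall (by linarith)))
      _ ≤ _ := le_mul_of_one_le_left' (one_le_pow₀ (by norm_num))
  refine two_pow_mul_withDensity_le_double hn hW hfin hK0 hKt hK hJ k hr ?_ (sep_subset _ _) ?_
  · exact measurableSet_closedBall.inter
      (measurableSet_lt measurable_const (hfm.sub_const _).abs)
  have hrate : (9 : ℝ≥0∞) ^ n * decayRate n J ≤ 2 ^ j := by
    calc (9 : ℝ≥0∞) ^ n * decayRate n J
        = 4 * ((9 * 144 * 40 * 16) ^ n * 2 ^ J) := by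
          unfold decayRate
          push_cast
          simp only [mul_pow]
          ring
      _ ≤ 2 ^ 2 * ((2 ^ 20) ^ n * 2 ^ J) := by
          gcongr <;> norm_num
      _ = 2 ^ j := by rw [hj, pow_add, pow_add, pow_mul, mul_assoc]
  have hpow : (9 : ℝ≥0∞) ^ n * decayRate n J ^ k ≤ 2 ^ (k * j) := by
    calc (9 : ℝ≥0∞) ^ n * decayRate n J ^ k ≤ (9 ^ n) ^ k * decayRate n J ^ k := by
          refine mul_le_mul_left (le_self_pow₀ (one_le_pow₀ ?_) hk.ne') _
          norm_num
      _ = (9 ^ n * decayRate n J) ^ k := (mul_pow _ _ _).symm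
      _ ≤ (2 ^ j) ^ k := by gcongr
      _ = 2 ^ (k * j) := by rw [← pow_mul, mul_comm]
  have hjn := john_nirenberg hn hfm hf hB h (k * j) x r hr
  rw [Nat.cast_mul, mul_assoc] at hjn
  refine le_trans ?_ hjn
  gcongr

lemma ofReal_rpow_le_tsum {D p t : ℝ} (hD : 0 < D) (hp : 1 ≤ p) (ht : 0 ≤ t) :
    ENNReal.ofReal (t ^ p) ≤ ∑' k : ℕ, ENNReal.ofReal ((4 * p * D) ^ p) * (3 / 2) ^ (k + 1) *
      {s : ℝ | k * D < s}.indicator 1 t := by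
  rcases ht.eq_or_lt with rfl | ht
  · rw [Real.zero_rpow (by linarith), ENNReal.ofReal_zero]
    exact zero_le
  obtain ⟨k, hk⟩ : ∃ k : ℕ, ⌈t / D⌉₊ = k + 1 :=
    Nat.exists_eq_succ_of_ne_zero (Nat.ceil_pos.2 (by positivity)).ne'
  have hlt : k * D < t := by
    rw [← lt_div_iff₀ hD, ← Nat.lt_ceil]
    omega
  have hle : t ≤ (k + 1) * D := by
    rw [← div_le_iff₀ hD]
    calc t / D ≤ ⌈t / D⌉₊ := Nat.le_ceil _
      _ = _ := by rw [hk]; push_cast; rfl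
  refine le_trans ?_ (ENNReal.le_tsum k)
  rw [indicator_of_mem (by exact hlt), Pi.one_apply, mul_one]
  have hexp : Real.exp (1 / 4) ≤ 3 / 2 := by
    have h4 : Real.exp (1 / 4) ^ 4 ≤ (3 / 2 : ℝ) ^ 4 := by
      rw [← Real.exp_nat_mul]
      norm_num
      linarith [Real.exp_one_lt_d9]
    exact le_of_pow_le_pow_left₀ (by norm_num) (by norm_num) h4
  have hpos : 0 < 4 * p * D := by positivity
  have key : t ^ p ≤ (4 * p * D) ^ p * (3 / 2) ^ (k + 1) := by
    have h1 : t ≤ 4 * p * D * Real.exp ((k + 1) / (4 * p)) := by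
      have h2 : ((k : ℝ) + 1) / (4 * p) ≤ Real.exp ((k + 1) / (4 * p)) := by
        linarith [Real.add_one_le_exp (((k : ℝ) + 1) / (4 * p))]
      calc t ≤ (k + 1) * D := hle
        _ = 4 * p * D * ((k + 1) / (4 * p)) := by field_simp
        _ ≤ _ := by gcongr
    calc t ^ p ≤ (4 * p * D * Real.exp ((k + 1) / (4 * p))) ^ p := by gcongr
      _ = (4 * p * D) ^ p * Real.exp (1 / 4) ^ (k + 1) := by
        rw [Real.mul_rpow hpos.le (Real.exp_pos _).le, ← Real.exp_mul, ← Real.exp_nat_mul]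
        congr 2
        push_cast
        field_simp
      _ ≤ _ := by gcongr
  refine (ENNReal.ofReal_le_ofReal key).trans_eq ?_
  rw [ENNReal.ofReal_mul (by positivity), ENNReal.ofReal_pow (by norm_num),
    ENNReal.ofReal_div_of_pos (by norm_num), ENNReal.ofReal_ofNat, ENNReal.ofReal_ofNat]

/-- Exponential decay of the distribution function gives moments growing linearly in `p`. -/
lemma lintegral_rpow_le_of_two_pow_mul_le {α : Type*} [MeasurableSpace α] (μ : Measure α)
    {g : α → ℝ} (hg : Measurable g) (hg0 : ∀ y, 0 ≤ g y) {D p : ℝ} (hD : 0 < D) (hp : 1 ≤ p)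
    {A : ℝ≥0∞} (h : ∀ k : ℕ, 2 ^ k * μ {y | k * D < g y} ≤ A) :
    ∫⁻ y, ENNReal.ofReal (g y ^ p) ∂μ ≤ ENNReal.ofReal ((4 * p * D) ^ p) * (6 * A) := by
  set C := ENNReal.ofReal ((4 * p * D) ^ p) with hC
  have hmeas (k : ℕ) : MeasurableSet {y | k * D < g y} := measurableSet_lt measurable_const hg
  have hlevel (k : ℕ) : μ {y | k * D < g y} ≤ (1 / 2) ^ k * A := by
    rw [one_div, ← ENNReal.inv_pow, ← ENNReal.div_eq_inv_mul,
      ENNReal.le_div_iff_mul_le (by simp) (by simp), mul_comm]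
    exact h k
  have hsum : ∑' k : ℕ, (3 / 2 : ℝ≥0∞) ^ (k + 1) * (1 / 2) ^ k = 6 := by
    have h1 (k : ℕ) : (3 / 2 : ℝ≥0∞) ^ (k + 1) * (1 / 2) ^ k = 3 / 2 * (3 / 4) ^ k := by
      have : (3 / 4 : ℝ≥0∞) = 3 / 2 * (1 / 2) := by
        rw [← ENNReal.toReal_eq_toReal_iff' (by finiteness) (by finiteness)]
        norm_num
      rw [this, mul_pow]
      ring
    simp_rw [h1]
    rw [ENNReal.tsum_mul_left, ENNReal.tsum_geometric]
    have h2 : (1 - 3 / 4 : ℝ≥0∞) = 4⁻¹ := by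
      refine ENNReal.sub_eq_of_eq_add (by finiteness) ?_
      rw [← ENNReal.toReal_eq_toReal_iff' (by finiteness) (by finiteness),
        ENNReal.toReal_add (by finiteness) (by finiteness)]
      norm_num
    rw [h2, inv_inv, ← ENNReal.toReal_eq_toReal_iff' (by finiteness) (by finiteness)]
    norm_num
  calc ∫⁻ y, ENNReal.ofReal (g y ^ p) ∂μ
      ≤ ∫⁻ y, ∑' k : ℕ, C * (3 / 2) ^ (k + 1) * {y | k * D < g y}.indicator 1 y ∂μ :=
        lintegral_mono fun y => ofReal_rpow_le_tsum hD hp (hg0 y)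
    _ = ∑' k : ℕ, C * (3 / 2) ^ (k + 1) * μ {y | k * D < g y} := by
        rw [lintegral_tsum fun k => ((measurable_one.indicator (hmeas k)).const_mul _).aemeasurable]
        congr with k
        rw [lintegral_const_mul _ (measurable_one.indicator (hmeas k)),
          lintegral_indicator_one (hmeas k)]
    _ ≤ ∑' k : ℕ, C * A * ((3 / 2) ^ (k + 1) * (1 / 2) ^ k) := by
        refine ENNReal.tsum_le_tsum fun k => ?_
        calc _ ≤ C * (3 / 2) ^ (k + 1) * ((1 / 2) ^ k * A) := by gcongr; exact hlevel k
          _ = _ := by ring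
    _ = C * (6 * A) := by
        rw [ENNReal.tsum_mul_left, hsum]
        ring

/-- The dimensional constant of the weighted John–Nirenberg moment inequality. -/
def momentConst (n : ℕ) : ℝ :=
  ((3 + 20 * n) * 40 ^ n + 8 * 14400 ^ n) * johnNirenbergStep n * 24 * 40 ^ n

lemma momentConst_pos (n : ℕ) : 0 < momentConst n := by
  unfold momentConst johnNirenbergStep
  positivity

lemma oscillation_moment_le {n : ℕ} (hn : n ≠ 0) {f : (Fin n → ℝ) → ℝ}
    (hfm : Measurable f) (hf : LocallyIntegrable f) {B : ℝ} (hB : 0 < B)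
    (h : ∀ x r, 0 < r → ∫⁻ y in closedBall x r,
      ENNReal.ofReal |f y - ⨍ z in closedBall x r, f z| ≤
        ENNReal.ofReal B * volume (closedBall x r))
    {W : (Fin n → ℝ) → ℝ≥0∞} (hW : Measurable W)
    (hfin : ∀ x r, ∫⁻ y in closedBall x r, W y ≠ ⊤) {K : ℝ} (hK1 : 1 ≤ 40 ^ n * K)
    (hK : ∀ x r, 0 < r → ∫⁻ y in closedBall x r, cubeMaximal ((closedBall x r).indicator W) y ≤
      ENNReal.ofReal K * volume.withDensity W (closedBall x (2 * r)))
    {p : ℝ} (hp : 1 ≤ p) {x : Fin n → ℝ} {r : ℝ} (hr : 0 < r) :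
    ((∫⁻ y in closedBall x r, ENNReal.ofReal (|f y - ⨍ z in closedBall x r, f z| ^ p)
        ∂volume.withDensity W) / volume.withDensity W (closedBall x (2 * r))) ^ (1 / p) ≤
      ENNReal.ofReal (momentConst n * p) * ENNReal.ofReal K * ENNReal.ofReal B := by
  set μ := volume.withDensity W with hμ
  have hK0 : 0 < K := pos_of_mul_pos_right (zero_lt_one.trans_le hK1) (by positivity)
  obtain ⟨J, hJ1, hJ2⟩ : ∃ J : ℕ, 8 * 14400 ^ n * K ≤ J ∧ (J : ℝ) ≤ 8 * 14400 ^ n * K + 1 :=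
    ⟨⌈8 * 14400 ^ n * K⌉₊, Nat.le_ceil _, (Nat.ceil_lt_add_one (by positivity)).le⟩
  have hJ : 4 * 360 ^ n * ENNReal.ofReal K * (2 * 40 ^ n : ℕ) ≤ (J : ℝ≥0∞) := by
    rw [← ENNReal.ofReal_natCast J]
    refine le_trans (le_of_eq ?_) (ENNReal.ofReal_le_ofReal hJ1)
    rw [ENNReal.ofReal_mul (by positivity), ENNReal.ofReal_mul (by positivity),
      ENNReal.ofReal_pow (by positivity), show (14400 : ℝ) = 360 * 40 by norm_num,
      ENNReal.ofReal_mul (by positivity)]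
    simp only [ENNReal.ofReal_ofNat, mul_pow]
    push_cast
    ring
  set D : ℝ := (2 + 20 * n + J : ℕ) * (johnNirenbergStep n * B) with hD
  have hs : 0 < johnNirenbergStep n := by
    unfold johnNirenbergStep
    positivity
  have hD0 : 0 < D := by positivity
  set c : ℝ≥0∞ := 6 * 40 ^ n with hc
  have hc1 : 1 ≤ c := by
    rw [hc]
    exact one_le_mul (by norm_num) (one_le_pow₀ (by norm_num))
  have hmom := lintegral_rpow_le_of_two_pow_mul_le (μ.restrict (closedBall x r))
    (g := fun y => |f y - ⨍ z in closedBall x r, f z|) (hfm.sub_const _).abs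
    (fun y => abs_nonneg _) hD0 hp (A := 40 ^ n * μ (closedBall x (2 * r))) fun k => by
      rw [Measure.restrict_apply
        (measurableSet_lt measurable_const (hfm.sub_const _).abs), inter_comm]
      exact two_pow_mul_withDensity_oscillation_le hn hfm hf hB h hW hfin
        (ENNReal.ofReal_pos.2 hK0).ne' ENNReal.ofReal_ne_top hK hJ k hr
  have hroot : ((∫⁻ y in closedBall x r,
      ENNReal.ofReal (|f y - ⨍ z in closedBall x r, f z| ^ p) ∂μ) /
        μ (closedBall x (2 * r))) ^ (1 / p) ≤ ENNReal.ofReal (4 * p * D) * c := by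
    have hp0 : 0 < p := by linarith
    calc _ ≤ (ENNReal.ofReal ((4 * p * D) ^ p) * c) ^ (1 / p) := by
          refine ENNReal.rpow_le_rpow (ENNReal.div_le_of_le_mul ?_) (by positivity)
          refine hmom.trans_eq ?_
          rw [hc]
          ring
      _ = ENNReal.ofReal (4 * p * D) * c ^ (1 / p) := by
          rw [ENNReal.mul_rpow_of_nonneg _ _ (by positivity),
            ← ENNReal.ofReal_rpow_of_nonneg (by positivity) hp0.le, ← ENNReal.rpow_mul,
            mul_one_div_cancel hp0.ne', ENNReal.rpow_one]
      _ ≤ ENNReal.ofReal (4 * p * D) * c ^ (1 : ℝ) := by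
          gcongr
          rwa [div_le_one hp0]
      _ = _ := by rw [ENNReal.rpow_one]
  refine hroot.trans ?_
  rw [hc, ← ENNReal.ofReal_ofNat 6, ← ENNReal.ofReal_ofNat 40, ← ENNReal.ofReal_pow (by norm_num),
    ← ENNReal.ofReal_mul (by norm_num), ← ENNReal.ofReal_mul (by positivity),
    ← ENNReal.ofReal_mul (mul_pos (momentConst_pos n) (by linarith)).le,
    ← ENNReal.ofReal_mul
      (mul_pos (mul_pos (momentConst_pos n) (by linarith)) hK0).le]
  refine ENNReal.ofReal_le_ofReal ?_
  have hj : ((2 + 20 * n + J : ℕ) : ℝ) ≤ ((3 + 20 * n) * 40 ^ n + 8 * 14400 ^ n) * K := by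
    push_cast
    calc (2 + 20 * n + J : ℝ) ≤ (3 + 20 * n) * 1 + 8 * 14400 ^ n * K := by linarith
      _ ≤ (3 + 20 * n) * (40 ^ n * K) + 8 * 14400 ^ n * K := by gcongr
      _ = _ := by ring
  calc 4 * p * D * (6 * 40 ^ n)
      = ((2 + 20 * n + J : ℕ) : ℝ) * (johnNirenbergStep n * B * 24 * 40 ^ n * p) := by
        rw [hD]
        ring
    _ ≤ ((3 + 20 * n) * 40 ^ n + 8 * 14400 ^ n) * K *
        (johnNirenbergStep n * B * 24 * 40 ^ n * p) := by gcongr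
    _ = _ := by
        unfold momentConst
        ring

lemma cube_eq_closedBall {n : ℕ} (a : Fin n → ℝ) {h : ℝ} (hh : 0 ≤ h) :
    Cube a h = closedBall (fun i => a i + h / 2) (h / 2) := by
  rw [closedBall_pi _ (by positivity), Cube]
  congr 1 with i
  rw [Real.closedBall_eq_Icc]
  ring_nf

lemma closedBall_eq_cube {n : ℕ} (x : Fin n → ℝ) {r : ℝ} (hr : 0 ≤ r) :
    closedBall x r = Cube (fun i => x i - r) (2 * r) := by
  rw [cube_eq_closedBall _ (by positivity)]
  congr 1 <;> ring_nf

lemma cube2_eq_closedBall {n : ℕ} (a : Fin n → ℝ) {h : ℝ} (hh : 0 ≤ h) :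
    Cube2 a h = closedBall (fun i => a i + h / 2) (2 * (h / 2)) := by
  rw [Cube2, cube_eq_closedBall _ (by positivity)]
  congr 1
  · ext i
    ring
  · ring

lemma lintegral_oscillation_le_bmoNorm_mul {n : ℕ} (f : (Fin n → ℝ) → ℝ) (a : Fin n → ℝ) {h : ℝ}
    (hh : 0 < h) :
    ∫⁻ y in Cube a h, ENNReal.ofReal |f y - cubeAvg a h f| ≤ bmoNorm f * volume (Cube a h) := by
  have hv : volume (Cube a h) ≠ 0 ∧ volume (Cube a h) ≠ ⊤ := by
    rw [cube_eq_closedBall a hh.le]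
    exact ⟨(measure_closedBall_pos volume _ (by positivity)).ne', measure_closedBall_lt_top.ne⟩
  rw [← ENNReal.div_le_iff_le_mul (.inl hv.1) (.inl hv.2)]
  exact le_iSup_of_le a (le_iSup_of_le h (le_iSup_of_le hh le_rfl))

lemma lintegral_maxFn_le_fwWeak_mul {n : ℕ} {w : (Fin n → ℝ) → ℝ} (hw : fwWeak w ≠ ⊤)
    (a : Fin n → ℝ) {h : ℝ} (hh : 0 < h) (hfin : wInt2 w a h ≠ ⊤) :
    ∫⁻ y in Cube a h, maxFn ((Cube a h).indicator w) y ≤ fwWeak w * wInt2 w a h := by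
  rw [← ENNReal.div_le_iff_le_mul (.inr hw) (.inl hfin)]
  exact le_iSup_of_le a (le_iSup_of_le h (le_iSup_of_le hh le_rfl))

lemma cubeMaximal_indicator_le_maxFn {n : ℕ} {w : (Fin n → ℝ) → ℝ}
    {W : (Fin n → ℝ) → ℝ≥0∞} (hW : ∀ᵐ y, W y = ENNReal.ofReal (w y)) (S : Set (Fin n → ℝ))
    (y : Fin n → ℝ) : cubeMaximal (S.indicator W) y ≤ maxFn (S.indicator w) y := by
  refine iSup_le fun x => iSup_le fun r => iSup_le fun hr => iSup_le fun hy => ?_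
  have hle : ∫⁻ z in closedBall x r, S.indicator W z ≤
      ∫⁻ z in closedBall x r, ENNReal.ofReal |S.indicator w z| := by
    refine lintegral_mono_ae (ae_restrict_of_ae ?_)
    filter_upwards [hW] with z hz
    by_cases hzS : z ∈ S
    · rw [indicator_of_mem hzS, indicator_of_mem hzS, hz]
      exact ENNReal.ofReal_le_ofReal (le_abs_self _)
    · rw [indicator_of_notMem hzS]
      exact zero_le
  rw [closedBall_eq_cube x hr.le] at hy hle ⊢
  refine (ENNReal.div_le_div_right hle _).trans ?_
  exact le_iSup_of_le _ (le_iSup_of_le _ (le_iSup_of_le (by positivity) (le_iSup_of_le hy le_rfl)))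

lemma le_lintegral_cubeMaximal_indicator {n : ℕ} (W : (Fin n → ℝ) → ℝ≥0∞) (x : Fin n → ℝ) {r : ℝ}
    (hr : 0 < r) : ∫⁻ y in closedBall x r, W y ≤
      ∫⁻ y in closedBall x r, cubeMaximal ((closedBall x r).indicator W) y := by
  set Q := closedBall x r with hQ
  have hv0 : volume Q ≠ 0 := (measure_closedBall_pos volume x hr).ne'
  have hvt : volume Q ≠ ⊤ := measure_closedBall_lt_top.ne
  calc ∫⁻ y in Q, W y = ∫⁻ _ in Q, (∫⁻ z in Q, Q.indicator W z) / volume Q := by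
        rw [setLIntegral_const, ENNReal.div_mul_cancel hv0 hvt]
        exact (setLIntegral_congr_fun measurableSet_closedBall
          fun z hz => indicator_of_mem hz W).symm
    _ ≤ _ := setLIntegral_mono' measurableSet_closedBall
        fun y hy => le_cubeMaximal (Q.indicator W) hr hy

/-- for `w ∈ A∞^{weak}` and `f ∈ BMO`, every cube `Q` and every `p ≥ 1`,
`((1/w(2Q)) ∫_Q |f - f_Q|^p w)^{1/p} ≤ c_n p [w]^{weak}_{A∞} ‖f‖_BMO`. -/
theorem stmt10 (n : ℕ) :
    ∃ c : ℝ, 0 < c ∧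
      ∀ (w f : (Fin n → ℝ) → ℝ), IsWeight w → fwWeak w < ⊤ →
        LocallyIntegrable f volume → bmoNorm f < ⊤ →
        ∀ (a : Fin n → ℝ) (h : ℝ), 0 < h → ∀ p : ℝ, 1 ≤ p →
          ((∫⁻ x in Cube a h, ENNReal.ofReal (|f x - cubeAvg a h f| ^ p * w x)) /
              wInt2 w a h) ^ (1 / p)
            ≤ ENNReal.ofReal (c * p) * fwWeak w * bmoNorm f := by
  rcases eq_or_ne n 0 with rfl | hn
  · refine ⟨1, one_pos, fun w f _ _ _ _ a h hh p hp => ?_⟩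
    have hzero (x : Fin 0 → ℝ) : f x - cubeAvg a h f = 0 := by
      have hv : volume (Cube a h) = 1 := by
        rw [cube_eq_closedBall a hh.le, volume_closedBall_fin _ (by positivity), pow_zero]
      have hf : f = fun _ => f x := funext fun y => congrArg f (Subsingleton.elim y x)
      rw [cubeAvg, hf, setAverage_const (by simp [hv]) (by simp [hv]), sub_self]
    simp only [hzero, abs_zero, Real.zero_rpow (by linarith : p ≠ 0), zero_mul,
      ENNReal.ofReal_zero, lintegral_zero, ENNReal.zero_div]
    rw [ENNReal.zero_rpow_of_pos (by positivity)]
    exact zero_le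
  refine ⟨momentConst n, momentConst_pos n, fun w f hw hwt hf hft a h hh p hp => ?_⟩
  have hp0 : 0 < 1 / p := by positivity
  have hzero_of (h0 : ∀ᵐ x ∂volume.restrict (Cube a h), |f x - cubeAvg a h f| ^ p * w x = 0) :
      ((∫⁻ x in Cube a h, ENNReal.ofReal (|f x - cubeAvg a h f| ^ p * w x)) /
        wInt2 w a h) ^ (1 / p) = 0 := by
    rw [lintegral_congr_ae (h0.mono fun x hx => by rw [hx]), ENNReal.ofReal_zero, lintegral_zero,
      ENNReal.zero_div, ENNReal.zero_rpow_of_pos hp0]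
  obtain ⟨w', hw'm, hww'⟩ := hw.2.aestronglyMeasurable
  obtain ⟨f', hf'm, hff'⟩ := hf.aestronglyMeasurable
  set W : (Fin n → ℝ) → ℝ≥0∞ := fun y => ENNReal.ofReal (w' y) with hWdef
  have hW : Measurable W := hw'm.measurable.ennreal_ofReal
  have hWw : ∀ᵐ y, W y = ENNReal.ofReal (w y) := hww'.mono fun y hy => by rw [hWdef, hy]
  have hWint (S : Set (Fin n → ℝ)) : ∫⁻ y in S, W y = ∫⁻ y in S, ENNReal.ofReal (w y) :=
    lintegral_congr_ae (ae_restrict_of_ae hWw)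
  have hfin (x : Fin n → ℝ) (r : ℝ) : ∫⁻ y in closedBall x r, W y ≠ ⊤ := by
    rw [hWint]
    exact (hw.2.integrableOn_isCompact (isCompact_closedBall x r)).lintegral_lt_top.ne
  have hμ (x : Fin n → ℝ) (r : ℝ) :
      volume.withDensity W (closedBall x r) = ∫⁻ y in closedBall x r, W y :=
    withDensity_apply W measurableSet_closedBall
  have hw2 {x : Fin n → ℝ} {r : ℝ} (hr : 0 < r) :
      wInt2 w (fun i => x i - r) (2 * r) = volume.withDensity W (closedBall x (2 * r)) := by
    rw [hμ, hWint, wInt2, cube2_eq_closedBall _ (by positivity)]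
    congr <;> ring_nf
  have hK (x : Fin n → ℝ) (r : ℝ) (hr : 0 < r) :
      ∫⁻ y in closedBall x r, cubeMaximal ((closedBall x r).indicator W) y ≤
        ENNReal.ofReal (fwWeak w).toReal * volume.withDensity W (closedBall x (2 * r)) := by
    have h1 := lintegral_maxFn_le_fwWeak_mul hwt.ne (fun i => x i - r)
      (by positivity : 0 < 2 * r) (by rw [hw2 hr, hμ]; exact hfin _ _)
    rw [hw2 hr, ← closedBall_eq_cube x hr.le] at h1
    rw [ENNReal.ofReal_toReal hwt.ne]
    exact (lintegral_mono fun y => cubeMaximal_indicator_le_maxFn hWw _ y).trans h1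
  have havg (S : Set (Fin n → ℝ)) : ⨍ z in S, f' z = ⨍ z in S, f z :=
    average_congr (ae_restrict_of_ae hff'.symm)
  have hosc (x : Fin n → ℝ) (r : ℝ) (hr : 0 < r) :
      ∫⁻ y in closedBall x r, ENNReal.ofReal |f' y - ⨍ z in closedBall x r, f' z| ≤
        ENNReal.ofReal (bmoNorm f).toReal * volume (closedBall x r) := by
    have h1 := lintegral_oscillation_le_bmoNorm_mul f (fun i => x i - r)
      (by positivity : 0 < 2 * r)
    rw [cubeAvg, ← closedBall_eq_cube x hr.le] at h1
    rw [ENNReal.ofReal_toReal hft.ne, havg]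
    refine le_trans (le_of_eq (lintegral_congr_ae (ae_restrict_of_ae ?_))) h1
    filter_upwards [hff'] with y hy
    rw [hy]
  rcases eq_or_ne (bmoNorm f) 0 with hB | hB
  · refine (hzero_of ?_).trans_le zero_le
    have h1 := lintegral_oscillation_le_bmoNorm_mul f a hh
    rw [hB, zero_mul, nonpos_iff_eq_zero, lintegral_eq_zero_iff'
      ((hf.aestronglyMeasurable.restrict.aemeasurable.sub_const _).abs.ennreal_ofReal)] at h1
    filter_upwards [h1] with x hx
    rw [Pi.zero_apply, ENNReal.ofReal_eq_zero] at hx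
    rw [le_antisymm hx (abs_nonneg _), Real.zero_rpow (by linarith), zero_mul]
  rcases lt_or_ge (40 ^ n * (fwWeak w).toReal) 1 with hlt | hge
  · refine (hzero_of ?_).trans_le zero_le
    have h1 := measure_closedBall_eq_zero_of_le_double hn (volume.withDensity W)
      (fun x r => by rw [hμ]; exact hfin x r)
      (fun x r hr => (hμ x r).trans_le
        ((le_lintegral_cubeMaximal_indicator W x hr).trans (hK x r hr)))
      (by
        rw [← ENNReal.ofReal_ofNat 40, ← ENNReal.ofReal_pow (by norm_num),
          ← ENNReal.ofReal_mul (by positivity)]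
        exact ENNReal.ofReal_lt_one.2 hlt) (fun i => a i + h / 2) (h / 2)
    rw [hμ, ← cube_eq_closedBall a hh.le, lintegral_eq_zero_iff hW] at h1
    filter_upwards [h1, ae_restrict_of_ae hWw] with x hx hxw
    rw [hxw, Pi.zero_apply, ENNReal.ofReal_eq_zero] at hx
    rw [le_antisymm hx (hw.1 x), mul_zero]
  have main := oscillation_moment_le hn hf'm.measurable (hf.congr hff')
    (ENNReal.toReal_pos hB hft.ne) hosc hW hfin hge hK hp (x := fun i => a i + h / 2)
    (r := h / 2) (by positivity)
  rw [ENNReal.ofReal_toReal hwt.ne, ENNReal.ofReal_toReal hft.ne] at main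
  refine le_trans (le_of_eq ?_) main
  rw [hμ, hWint, wInt2, cube2_eq_closedBall a hh.le, ← cube_eq_closedBall a hh.le,
    setLIntegral_withDensity_eq_setLIntegral_mul _ hW
      (((hf'm.measurable.sub_const _).abs.pow_const p).ennreal_ofReal)
      (by rw [cube_eq_closedBall a hh.le]; exact measurableSet_closedBall), havg, ← cubeAvg]
  congr 2
  refine lintegral_congr_ae (ae_restrict_of_ae ?_)
  filter_upwards [hff', hWw] with y hy hyw
  rw [Pi.mul_apply, hyw, ← hy, mul_comm, ENNReal.ofReal_mul (hw.1 y)]
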